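/- arXiv:2401.03937 — 4 statements merged into one kernel-verified Lean document; each statement's English description precedes it below -/
import Mathlib

section
/- Concentration for low-degree functions on the symmetric group: Let n ≥ 1, d ∈ {1,…,n}, let σ be a uniformly random permutation of [n], and let φ be a multilinear polynomial of degree at most d with non-negative coefficients. Suppose there exist constants C_D, C'_D, C_U ≥ 0 such that for every integer 0 ≤ k ≤ d: ‖D^k φ‖_∞ ≤ C_D, ‖∇ D^k φ‖_∞ ≤ C'_D, and ‖D^k U φ‖_∞ ≤ C_U. Define β_φ := 6·d·C'_D·( max(0, log(4·C_D·n/C'_D)) + (2/n)(2 − e^{−2/n})/(1 − e^{−2/n}) ) and γ_φ := (2β_φ/3)·(2·E[φ] + C_U). Then for all t ≥ 0: P[φ(σ) − E[φ] ≥ t] ≤ exp( −t² / (2(γ_φ + β_φ t)) ) and P[φ(σ) − E[φ] ≤ −t] ≤ exp( −t² / (2γ_φ) ). -/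
open MvPolynomial

noncomputable section

/-- The permutation matrix of `σ`, as an assignment of values to the indeterminates `X_{ij}`. -/
def permMat (n : ℕ) (σ : Equiv.Perm (Fin n)) : Fin n × Fin n → ℝ :=
  fun p => if σ p.1 = p.2 then 1 else 0

/-- Evaluation of a polynomial in the indeterminates `X_{ij}` at the permutation matrix of `σ`. -/
def permEval (n : ℕ) (φ : MvPolynomial (Fin n × Fin n) ℝ) (σ : Equiv.Perm (Fin n)) : ℝ :=
  eval (permMat n σ) φ

/-- Multilinearity: `∂_{ij}∂_{ik} φ ≡ 0` and `∂_{ji}∂_{ki} φ ≡ 0` for all `i, j, k`. -/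
def IsMultilinear (n : ℕ) (φ : MvPolynomial (Fin n × Fin n) ℝ) : Prop :=
  ∀ i j k : Fin n,
    pderiv (i, j) (pderiv (i, k) φ) = 0 ∧ pderiv (j, i) (pderiv (k, i) φ) = 0

/-- The operator `D`, defined on homogeneous components by
`Dφ = (1/(dn)) ∑_{ij} ∂_{ij} φ` and extended linearly (annihilating constants). -/
def Dop (n : ℕ) (φ : MvPolynomial (Fin n × Fin n) ℝ) : MvPolynomial (Fin n × Fin n) ℝ :=
  ∑ d ∈ Finset.range (φ.totalDegree + 1),
    (1 / ((d : ℝ) * (n : ℝ))) •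
      ∑ i : Fin n, ∑ j : Fin n, pderiv (i, j) (homogeneousComponent d φ)

/-- The operator `U`, defined on homogeneous components by
`Uφ(X) = (1/(dn)) ∑_{ijkl} X_{il} X_{kj} ∂_{ij}∂_{kl} φ(X)` and extended linearly. -/
def Uop (n : ℕ) (φ : MvPolynomial (Fin n × Fin n) ℝ) : MvPolynomial (Fin n × Fin n) ℝ :=
  ∑ d ∈ Finset.range (φ.totalDegree + 1),
    (1 / ((d : ℝ) * (n : ℝ))) •
      ∑ i : Fin n, ∑ j : Fin n, ∑ k : Fin n, ∑ l : Fin n,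
        X (i, l) * X (k, j) * pderiv (i, j) (pderiv (k, l) (homogeneousComponent d φ))

/-- Mean of `φ(σ)` over a uniformly random permutation `σ`. -/
def permExp (n : ℕ) (φ : MvPolynomial (Fin n × Fin n) ℝ) : ℝ :=
  (∑ σ : Equiv.Perm (Fin n), permEval n φ σ) / (Fintype.card (Equiv.Perm (Fin n)) : ℝ)

/-- Probability of an event under the uniform measure on the symmetric group. -/
def permProb (n : ℕ) (p : Equiv.Perm (Fin n) → Prop) : ℝ :=
  (Set.ncard {σ : Equiv.Perm (Fin n) | p σ} : ℝ) / (Fintype.card (Equiv.Perm (Fin n)) : ℝ)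

/-- The constant `β_φ`. -/
def betaConst (n d : ℕ) (CD CD' : ℝ) : ℝ :=
  6 * (d : ℝ) * CD' * (max 0 (Real.log (4 * CD * (n : ℝ) / CD')) +
    (2 / (n : ℝ)) * (2 - Real.exp (-2 / (n : ℝ))) / (1 - Real.exp (-2 / (n : ℝ))))

/-- The constant `γ_φ`. -/
def gammaConst (n d : ℕ) (CD CD' CU EΦ : ℝ) : ℝ :=
  2 * betaConst n d CD CD' / 3 * (2 * EΦ + CU)

/-- The entropy functional of `g` under counting measure, normalised by the size of the index set. -/
def ent {ι : Type*} [Fintype ι] (g : ι → ℝ) : ℝ :=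
  ∑ x, g x * Real.log (g x) - (∑ x, g x) * Real.log ((∑ x, g x) / Fintype.card ι)

/-- The integrand `(a - b)(log a - log b)` of the entropy production. -/
def entProd (a b : ℝ) : ℝ := (a - b) * (Real.log a - Real.log b)

lemma entProd_self (a : ℝ) : entProd a a = 0 := by simp [entProd]

lemma entProd_comm (a b : ℝ) : entProd a b = entProd b a := by unfold entProd; ring

lemma entProd_nonneg {a b : ℝ} (ha : 0 < a) (hb : 0 < b) : 0 ≤ entProd a b := by
  unfold entProd
  rcases le_total a b with h | h
  · exact mul_nonneg_of_nonpos_of_nonpos (by linarith)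
      (by linarith [Real.log_le_log ha h])
  · exact mul_nonneg (by linarith) (by linarith [Real.log_le_log hb h])

lemma log_sum_inequality {ι : Type*} [Fintype ι] {a b : ι → ℝ} (ha : ∀ x, 0 < a x)
    (hb : ∀ x, 0 < b x) :
    (∑ x, a x) * (Real.log (∑ x, a x) - Real.log (∑ x, b x)) ≤
      ∑ x, a x * (Real.log (a x) - Real.log (b x)) := by
  rcases isEmpty_or_nonempty ι with h | h
  · simp
  have hA : 0 < ∑ x, a x := Finset.sum_pos (fun x _ => ha x) Finset.univ_nonempty
  have hB : 0 < ∑ x, b x := Finset.sum_pos (fun x _ => hb x) Finset.univ_nonempty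
  set A := ∑ x, a x with hAdef
  set B := ∑ x, b x with hBdef
  have key : ∀ x, a x * (Real.log A - Real.log B) - a x * (Real.log (a x) - Real.log (b x)) ≤
      b x * (A / B) - a x := by
    intro x
    have h1 := Real.log_le_sub_one_of_pos
      (div_pos (mul_pos (hb x) hA) (mul_pos (ha x) hB))
    rw [Real.log_div (mul_pos (hb x) hA).ne' (mul_pos (ha x) hB).ne',
      Real.log_mul (hb x).ne' hA.ne', Real.log_mul (ha x).ne' hB.ne'] at h1
    have h2 := mul_le_mul_of_nonneg_left h1 (ha x).le
    have h3 : a x * (b x * A / (a x * B) - 1) = b x * (A / B) - a x := by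
      have := (ha x).ne'
      field_simp
    linarith
  have hsum := Finset.sum_le_sum (fun x (_ : x ∈ Finset.univ) => key x)
  rw [Finset.sum_sub_distrib, Finset.sum_sub_distrib, ← Finset.sum_mul, ← Finset.sum_mul,
    ← hAdef, ← hBdef, mul_div_cancel₀ _ hB.ne'] at hsum
  linarith

lemma entProd_sum_le {ι : Type*} [Fintype ι] {a b : ι → ℝ} (ha : ∀ x, 0 < a x)
    (hb : ∀ x, 0 < b x) :
    entProd (∑ x, a x) (∑ x, b x) ≤ ∑ x, entProd (a x) (b x) := by
  have h1 := log_sum_inequality ha hb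
  have h2 := log_sum_inequality hb ha
  have h3 : ∑ x, entProd (a x) (b x) = ∑ x, a x * (Real.log (a x) - Real.log (b x)) +
      ∑ x, b x * (Real.log (b x) - Real.log (a x)) := by
    rw [← Finset.sum_add_distrib]
    exact Finset.sum_congr rfl fun x _ => by unfold entProd; ring
  rw [h3]
  unfold entProd
  linarith

lemma ent_le_sum_entProd {ι : Type*} [Fintype ι] [Nonempty ι] {G : ι → ℝ} (hG : ∀ x, 0 < G x) :
    ent G ≤ 1 / (2 * Fintype.card ι) * ∑ x, ∑ y, entProd (G x) (G y) := by
  have hN : (0 : ℝ) < Fintype.card ι := by exact_mod_cast Fintype.card_pos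
  set N : ℝ := (Fintype.card ι : ℝ) with hNdef
  have hS : 0 < ∑ x, G x := Finset.sum_pos (fun x _ => hG x) Finset.univ_nonempty
  have hlog : ∑ x, Real.log (G x) ≤ N * Real.log ((∑ x, G x) / N) := by
    have key : ∀ x, Real.log (G x) ≤
        Real.log ((∑ x, G x) / N) + (G x * (N / ∑ x, G x) - 1) := by
      intro x
      have h1 := Real.log_le_sub_one_of_pos (div_pos (hG x) (div_pos hS hN))
      rw [Real.log_div (hG x).ne' (div_pos hS hN).ne', div_div_eq_mul_div, mul_div_assoc] at h1
      linarith
    have hsum := Finset.sum_le_sum (fun x (_ : x ∈ Finset.univ) => key x)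
    rw [Finset.sum_add_distrib, Finset.sum_sub_distrib, ← Finset.sum_mul,
      mul_div_cancel₀ _ hS.ne'] at hsum
    simpa [hNdef] using hsum
  have hexp : ∑ x, ∑ y, entProd (G x) (G y) =
      2 * (N * ∑ x, G x * Real.log (G x) - (∑ x, G x) * ∑ x, Real.log (G x)) := by
    have h : ∀ x y, entProd (G x) (G y) = G x * Real.log (G x) + G y * Real.log (G y)
        - G x * Real.log (G y) - G y * Real.log (G x) := fun x y => by unfold entProd; ring
    have h' : ∀ x, ∑ y, entProd (G x) (G y) = N * (G x * Real.log (G x)) +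
        ∑ y, G y * Real.log (G y) - G x * ∑ y, Real.log (G y) -
        (∑ y, G y) * Real.log (G x) := by
      intro x
      simp only [h, Finset.sum_sub_distrib, Finset.sum_add_distrib, ← Finset.mul_sum,
        ← Finset.sum_mul, Finset.sum_const, Finset.card_univ, nsmul_eq_mul, ← hNdef]
      ring
    simp only [h', Finset.sum_sub_distrib, Finset.sum_add_distrib, ← Finset.mul_sum,
      ← Finset.sum_mul, Finset.sum_const, Finset.card_univ, nsmul_eq_mul, ← hNdef]
    ring
  rw [hexp]
  have h2 := mul_le_mul_of_nonneg_left hlog hS.le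
  have h3 : 1 / (2 * N) * (2 * (N * ∑ x, G x * Real.log (G x) -
      (∑ x, G x) * ∑ x, Real.log (G x))) =
      ∑ x, G x * Real.log (G x) - (∑ x, G x) * (∑ x, Real.log (G x)) / N := by
    field_simp
  rw [h3]
  unfold ent
  have h4 : (∑ x, G x) * (∑ x, Real.log (G x)) / N ≤
      (∑ x, G x) * Real.log ((∑ x, G x) / N) := by
    rw [div_le_iff₀ hN]
    linarith
  rw [← hNdef]
  linarith

lemma ent_comp_equiv {ι κ : Type*} [Fintype ι] [Fintype κ] (e : ι ≃ κ) (g : κ → ℝ) :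
    ent (fun x => g (e x)) = ent g := by
  unfold ent
  rw [Equiv.sum_comp e g, Equiv.sum_comp e (fun y => g y * Real.log (g y)),
    Fintype.card_congr e]

lemma ent_prod {ι κ : Type*} [Fintype ι] [Fintype κ] [Nonempty ι] [Nonempty κ]
    {w : ι × κ → ℝ} (hw : ∀ x, 0 < w x) :
    ent w = ∑ p, ent (fun e => w (p, e)) + ent (fun p => ∑ e, w (p, e)) := by
  have hι : (0 : ℝ) < Fintype.card ι := by exact_mod_cast Fintype.card_pos
  have hκ : (0 : ℝ) < Fintype.card κ := by exact_mod_cast Fintype.card_pos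
  have hG : ∀ p, 0 < ∑ e, w (p, e) :=
    fun p => Finset.sum_pos (fun e _ => hw _) Finset.univ_nonempty
  have hS : 0 < ∑ p, ∑ e, w (p, e) := Finset.sum_pos (fun p _ => hG p) Finset.univ_nonempty
  unfold ent
  simp only [Fintype.sum_prod_type, Fintype.card_prod, Finset.sum_sub_distrib, Nat.cast_mul]
  rw [Real.log_div hS.ne' (mul_pos hι hκ).ne', Real.log_mul hι.ne' hκ.ne',
    Real.log_div hS.ne' hι.ne']
  have h : ∀ p, (∑ e, w (p, e)) * Real.log ((∑ e, w (p, e)) / Fintype.card κ) =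
      (∑ e, w (p, e)) * Real.log (∑ e, w (p, e)) -
        (∑ e, w (p, e)) * Real.log (Fintype.card κ) := by
    intro p
    rw [Real.log_div (hG p).ne' hκ.ne', mul_sub]
  simp_rw [h, Finset.sum_sub_distrib, ← Finset.sum_mul]
  ring

open Equiv Equiv.Perm in
lemma decomposeFin_symm_swap_mul {n : ℕ} (p : Fin (n + 1)) (j l : Fin n) (e : Perm (Fin n)) :
    decomposeFin.symm (p, swap j l * e) =
      swap (swap 0 p j.succ) (swap 0 p l.succ) * decomposeFin.symm (p, e) := by
  ext x
  congr 1
  refine Fin.cases ?_ (fun x => ?_) x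
  · rw [Perm.mul_apply, decomposeFin_symm_apply_zero, decomposeFin_symm_apply_zero]
    have hne : ∀ j : Fin n, p ≠ swap 0 p j.succ := by
      intro j h
      rw [eq_comm, swap_apply_eq_iff, swap_apply_right] at h
      exact Fin.succ_ne_zero j h
    rw [swap_apply_of_ne_of_ne (hne j) (hne l)]
  · rw [Perm.mul_apply, decomposeFin_symm_apply_succ, decomposeFin_symm_apply_succ,
      (swap 0 p).swap_apply_apply]
    simp only [Perm.mul_apply, swap_inv, swap_apply_self]
    congr 1
    simp only [swap_apply_def]
    split_ifs <;> simp_all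

open Equiv Equiv.Perm in
lemma sum_decomposeFin_symm {n : ℕ} (p : Fin (n + 1)) (h : Perm (Fin (n + 1)) → ℝ) :
    ∑ e, h (decomposeFin.symm (p, e)) = ∑ σ, if σ 0 = p then h σ else 0 := by
  rw [← Equiv.sum_comp decomposeFin.symm, Fintype.sum_prod_type]
  simp

open Equiv in
/-- Total entropy production over all transpositions. -/
def swapEnergy {n : ℕ} (g : Perm (Fin n) → ℝ) : ℝ :=
  ∑ σ, ∑ j, ∑ l, entProd (g σ) (g (swap j l * σ))

open Equiv in
/-- Entropy production over the transpositions moving the value at position `i`. -/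
def swapEnergyAt {n : ℕ} (g : Perm (Fin n) → ℝ) (i : Fin n) : ℝ :=
  ∑ σ, ∑ l, entProd (g σ) (g (swap (σ i) l * σ))

lemma sum_swap_succ {n : ℕ} (p : Fin (n + 1)) (F : Fin (n + 1) → ℝ) :
    ∑ j : Fin n, F (Equiv.swap 0 p j.succ) = ∑ q, F q - F p := by
  rw [← Equiv.sum_comp (Equiv.swap 0 p) F, Fin.sum_univ_succ]
  simp

open Equiv Equiv.Perm in
lemma ent_le_of_ent_le_succ {n : ℕ} {a : ℝ}
    (ih : ∀ g : Perm (Fin n) → ℝ, (∀ σ, 0 < g σ) → ent g ≤ a * swapEnergy g)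
    (g : Perm (Fin (n + 1)) → ℝ) (hg : ∀ σ, 0 < g σ) :
    ent g ≤ a * (swapEnergy g - 2 * swapEnergyAt g 0) +
      1 / (2 * ((n + 1 : ℕ) : ℝ)) * swapEnergyAt g 0 := by
  rw [← ent_comp_equiv decomposeFin.symm g, ent_prod (fun _ => hg _)]
  have hE : swapEnergy g = ∑ p, ∑ e, ∑ j, ∑ l, entProd (g (decomposeFin.symm (p, e)))
      (g (swap j l * decomposeFin.symm (p, e))) := by
    unfold swapEnergy
    rw [← Equiv.sum_comp decomposeFin.symm, Fintype.sum_prod_type]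
  have hR : swapEnergyAt g 0 = ∑ p, ∑ e, ∑ l, entProd (g (decomposeFin.symm (p, e)))
      (g (swap p l * decomposeFin.symm (p, e))) := by
    unfold swapEnergyAt
    rw [← Equiv.sum_comp decomposeFin.symm, Fintype.sum_prod_type]
    simp
  refine add_le_add ?_ ?_
  · rw [hE, hR, Finset.mul_sum, ← Finset.sum_sub_distrib, Finset.mul_sum]
    refine Finset.sum_le_sum fun p _ => (ih _ fun _ => hg _).trans (le_of_eq ?_)
    congr 1
    unfold swapEnergy
    rw [Finset.mul_sum, ← Finset.sum_sub_distrib]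
    refine Finset.sum_congr rfl fun e _ => ?_
    simp_rw [decomposeFin_symm_swap_mul]
    have h1 : ∀ j : Fin n, ∑ l : Fin n, entProd (g (decomposeFin.symm (p, e)))
        (g (swap (swap 0 p j.succ) (swap 0 p l.succ) * decomposeFin.symm (p, e))) = _ :=
      fun j => sum_swap_succ p (fun r => entProd (g (decomposeFin.symm (p, e)))
        (g (swap (swap 0 p j.succ) r * decomposeFin.symm (p, e))))
    simp_rw [h1, Finset.sum_sub_distrib]
    rw [sum_swap_succ p (fun q => ∑ r, entProd (g (decomposeFin.symm (p, e)))
        (g (swap q r * decomposeFin.symm (p, e)))),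
      sum_swap_succ p (fun q => entProd (g (decomposeFin.symm (p, e)))
        (g (swap q p * decomposeFin.symm (p, e))))]
    simp only [swap_comm _ p, swap_self, ← Perm.one_def, one_mul, entProd_self]
    ring
  · refine (ent_le_sum_entProd
      (fun p => Finset.sum_pos (fun e _ => hg _) Finset.univ_nonempty)).trans ?_
    rw [Fintype.card_fin]
    refine mul_le_mul_of_nonneg_left ?_ (by positivity)
    rw [hR]
    refine Finset.sum_le_sum fun p _ => ?_
    rw [Finset.sum_comm (s := (Finset.univ : Finset (Perm (Fin n))))]
    refine Finset.sum_le_sum fun q _ => ?_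
    have h2 : ∑ e, g (decomposeFin.symm (q, e)) =
        ∑ e, g (swap p q * decomposeFin.symm (p, e)) := by
      rw [sum_decomposeFin_symm q g, sum_decomposeFin_symm p (fun σ => g (swap p q * σ)),
        ← Equiv.sum_comp (Equiv.mulLeft (swap p q))]
      refine Finset.sum_congr rfl fun σ _ => ?_
      have : swap p q (σ 0) = q ↔ σ 0 = p := by
        rw [swap_apply_eq_iff, swap_apply_right]
      simp [this]
    rw [h2]
    exact entProd_sum_le (fun _ => hg _) (fun _ => hg _)

open Equiv in
/-- Modified logarithmic Sobolev inequality for the random transposition walk. -/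
theorem ent_le_swapEnergy (n : ℕ) (g : Perm (Fin n) → ℝ) (hg : ∀ σ, 0 < g σ) :
    ent g ≤ 1 / (2 * (n : ℝ)) * swapEnergy g := by
  induction n with
  | zero => simp [ent, swapEnergy]
  | succ n ih =>
    have hS : 0 ≤ swapEnergy g := Finset.sum_nonneg fun σ _ => Finset.sum_nonneg fun j _ =>
      Finset.sum_nonneg fun l _ => entProd_nonneg (hg _) (hg _)
    have step : ∀ i, ent g ≤ 1 / (2 * (n : ℝ)) * (swapEnergy g - 2 * swapEnergyAt g i) +
        1 / (2 * ((n + 1 : ℕ) : ℝ)) * swapEnergyAt g i := by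
      intro i
      have h := ent_le_of_ent_le_succ ih (fun σ => g (σ * swap 0 i)) (fun _ => hg _)
      have h1 : ent (fun σ => g (σ * swap 0 i)) = ent g :=
        ent_comp_equiv (Equiv.mulRight (swap 0 i)) g
      have h2 : swapEnergy (fun σ => g (σ * swap 0 i)) = swapEnergy g := by
        unfold swapEnergy
        rw [← Equiv.sum_comp (Equiv.mulRight (swap 0 i))]
        simp [mul_assoc]
      have h3 : swapEnergyAt (fun σ => g (σ * swap 0 i)) 0 = swapEnergyAt g i := by
        unfold swapEnergyAt
        rw [← Equiv.sum_comp (Equiv.mulRight (swap 0 i))]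
        simp [mul_assoc]
      rwa [h1, h2, h3] at h
    have hsum : ∑ i, swapEnergyAt g i = swapEnergy g := by
      unfold swapEnergyAt swapEnergy
      rw [Finset.sum_comm]
      refine Finset.sum_congr rfl fun σ _ => ?_
      exact Equiv.sum_comp σ (fun j => ∑ l, entProd (g σ) (g (swap j l * σ)))
    have htot := Finset.sum_le_sum (fun i (_ : i ∈ Finset.univ) => step i)
    rw [Finset.sum_add_distrib, ← Finset.mul_sum, ← Finset.mul_sum, Finset.sum_sub_distrib,
      ← Finset.mul_sum, hsum] at htot
    simp only [Finset.sum_const, Finset.card_univ, Fintype.card_fin, nsmul_eq_mul] at htot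
    have hc : 1 / (2 * (n : ℝ)) * ((n + 1 : ℕ) - 2) + 1 / (2 * ((n + 1 : ℕ) : ℝ)) ≤ 1 / 2 := by
      rcases Nat.eq_zero_or_pos n with rfl | hn
      · norm_num
      · have : (0 : ℝ) < n := by exact_mod_cast hn
        push_cast
        rw [← sub_nonneg]
        have e : 1 / 2 - (1 / (2 * (n : ℝ)) * ((n : ℝ) + 1 - 2) + 1 / (2 * ((n : ℝ) + 1))) =
          1 / (2 * n * (n + 1)) := by field_simp; ring
        rw [e]; positivity
    have hN : (0 : ℝ) < ((n + 1 : ℕ) : ℝ) := by positivity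
    have h5 := mul_le_mul_of_nonneg_right hc hS
    have h6 : ((n + 1 : ℕ) : ℝ) * ent g ≤ 1 / 2 * swapEnergy g := by linarith
    have h7 : 1 / (2 * ((n + 1 : ℕ) : ℝ)) * swapEnergy g =
      (1 / 2 * swapEnergy g) / ((n + 1 : ℕ) : ℝ) := by field_simp
    rw [h7, le_div_iff₀ hN]
    linarith

open Equiv in
/-- Entropy bound for the exponential of a function whose decrease under a transposition is
controlled by local contributions `Q i`. -/
lemma ent_exp_le {n : ℕ} (hn : 1 ≤ n) {f F : Perm (Fin n) → ℝ} {Q : Fin n → Perm (Fin n) → ℝ}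
    {d M κ θ : ℝ} (hM : 0 ≤ M) (hκ0 : 0 ≤ κ) (hQ0 : ∀ i σ, 0 ≤ Q i σ)
    (hQM : ∀ i σ, Q i σ ≤ M) (hQs : ∀ σ, ∑ i, Q i σ ≤ d * F σ)
    (hdiff : ∀ σ j l, f σ - f (swap j l * σ) ≤ Q (σ⁻¹ j) σ + Q (σ⁻¹ l) σ)
    (hκ : ∀ x y, y ≤ x → x - y ≤ 2 * M →
      (Real.exp (θ * x) - Real.exp (θ * y)) * (θ * x - θ * y) ≤
        κ * θ ^ 2 * (x - y) ^ 2 * Real.exp (θ * x)) :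
    ent (fun σ => Real.exp (θ * f σ)) ≤
      κ * θ ^ 2 * (4 * d * M) * ∑ σ, F σ * Real.exp (θ * f σ) := by
  have hn' : (0 : ℝ) < n := by exact_mod_cast hn
  set P : Perm (Fin n) → Perm (Fin n) → ℝ :=
    fun σ τ => entProd (Real.exp (θ * f σ)) (Real.exp (θ * f τ)) with hP
  set A : Perm (Fin n) → Perm (Fin n) → ℝ :=
    fun σ τ => if f τ ≤ f σ then P σ τ else 0 with hA
  have hP0 : ∀ σ τ, 0 ≤ P σ τ := fun σ τ => entProd_nonneg (Real.exp_pos _) (Real.exp_pos _)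
  have hA0 : ∀ σ τ, 0 ≤ A σ τ := fun σ τ => by
    simp only [hA]; split_ifs <;> simp [hP0]
  have hPA : ∀ σ τ, P σ τ ≤ A σ τ + A τ σ := by
    intro σ τ
    rcases le_total (f τ) (f σ) with h | h
    · have : A σ τ = P σ τ := if_pos h
      linarith [hA0 τ σ]
    · have h1 : A τ σ = P τ σ := if_pos h
      have h2 : P τ σ = P σ τ := entProd_comm _ _
      linarith [hA0 σ τ]
  have hAle : ∀ σ j l, A σ (swap j l * σ) ≤
      κ * θ ^ 2 * (2 * M) * Real.exp (θ * f σ) * (Q (σ⁻¹ j) σ + Q (σ⁻¹ l) σ) := by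
    intro σ j l
    have hq : 0 ≤ Q (σ⁻¹ j) σ + Q (σ⁻¹ l) σ := add_nonneg (hQ0 _ _) (hQ0 _ _)
    have hqM : Q (σ⁻¹ j) σ + Q (σ⁻¹ l) σ ≤ 2 * M := by
      linarith [hQM (σ⁻¹ j) σ, hQM (σ⁻¹ l) σ]
    by_cases h : f (swap j l * σ) ≤ f σ
    · have h1 : A σ (swap j l * σ) = P σ (swap j l * σ) := if_pos h
      have hd := hdiff σ j l
      rw [h1]
      simp only [hP, entProd, Real.log_exp]
      refine (hκ _ _ h (hd.trans hqM)).trans ?_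
      have h2 : (f σ - f (swap j l * σ)) ^ 2 ≤ 2 * M * (Q (σ⁻¹ j) σ + Q (σ⁻¹ l) σ) := by
        rw [sq]
        exact mul_le_mul (hd.trans hqM) hd (by linarith) (by linarith)
      calc κ * θ ^ 2 * (f σ - f (swap j l * σ)) ^ 2 * Real.exp (θ * f σ)
          ≤ κ * θ ^ 2 * (2 * M * (Q (σ⁻¹ j) σ + Q (σ⁻¹ l) σ)) * Real.exp (θ * f σ) := by
            gcongr
        _ = _ := by ring
    · have h1 : A σ (swap j l * σ) = 0 := if_neg h
      rw [h1]
      positivity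
  have hswap : ∀ j l, ∑ σ, A (swap j l * σ) σ = ∑ σ, A σ (swap j l * σ) := by
    intro j l
    rw [← Equiv.sum_comp (Equiv.mulLeft (swap j l))]
    simp [← mul_assoc]
  have hE : swapEnergy (fun σ => Real.exp (θ * f σ)) ≤
      2 * ∑ σ, ∑ j, ∑ l, A σ (swap j l * σ) := by
    calc swapEnergy (fun σ => Real.exp (θ * f σ))
        ≤ ∑ σ, ∑ j, ∑ l, (A σ (swap j l * σ) + A (swap j l * σ) σ) :=
          Finset.sum_le_sum fun σ _ => Finset.sum_le_sum fun j _ =>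
            Finset.sum_le_sum fun l _ => hPA _ _
      _ = ∑ σ, ∑ j, ∑ l, A σ (swap j l * σ) + ∑ σ, ∑ j, ∑ l, A (swap j l * σ) σ := by
          simp only [Finset.sum_add_distrib]
      _ = _ := by
          have : ∑ σ, ∑ j, ∑ l, A (swap j l * σ) σ = ∑ σ, ∑ j, ∑ l, A σ (swap j l * σ) := by
            rw [Finset.sum_comm, Finset.sum_comm (s := (Finset.univ : Finset (Perm (Fin n))))]
            refine Finset.sum_congr rfl fun j _ => ?_
            rw [Finset.sum_comm, Finset.sum_comm (s := (Finset.univ : Finset (Perm (Fin n))))]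
            exact Finset.sum_congr rfl fun l _ => hswap j l
          rw [this]; ring
  have hsumA : ∀ σ, ∑ j, ∑ l, A σ (swap j l * σ) ≤
      κ * θ ^ 2 * (2 * M) * Real.exp (θ * f σ) * (2 * n * (d * F σ)) := by
    intro σ
    calc ∑ j, ∑ l, A σ (swap j l * σ)
        ≤ ∑ j, ∑ l, κ * θ ^ 2 * (2 * M) * Real.exp (θ * f σ) *
          (Q (σ⁻¹ j) σ + Q (σ⁻¹ l) σ) :=
          Finset.sum_le_sum fun j _ => Finset.sum_le_sum fun l _ => hAle _ _ _
      _ = κ * θ ^ 2 * (2 * M) * Real.exp (θ * f σ) * (2 * n * ∑ i, Q i σ) := by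
          simp only [← Finset.mul_sum, Finset.sum_add_distrib, Finset.sum_const,
            Finset.card_univ, Fintype.card_fin, nsmul_eq_mul]
          rw [Equiv.sum_comp σ⁻¹ (fun i => Q i σ)]
          ring
      _ ≤ _ := by
          gcongr
          exact hQs σ
  refine (ent_le_swapEnergy n _ fun σ => Real.exp_pos _).trans ?_
  calc 1 / (2 * (n : ℝ)) * swapEnergy (fun σ => Real.exp (θ * f σ))
      ≤ 1 / (2 * (n : ℝ)) * (2 * ∑ σ, κ * θ ^ 2 * (2 * M) * Real.exp (θ * f σ) *
          (2 * n * (d * F σ))) := by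
        refine mul_le_mul_of_nonneg_left (hE.trans ?_) (by positivity)
        exact mul_le_mul_of_nonneg_left (Finset.sum_le_sum fun σ _ => hsumA σ) (by norm_num)
    _ = _ := by
        rw [Finset.mul_sum, Finset.mul_sum, Finset.mul_sum]
        refine Finset.sum_congr rfl fun σ _ => ?_
        field_simp
        ring

open Filter Topology in
/-- Herbst's argument: an entropy bound for `exp (θ f)` integrates to a bound on the logarithmic
moment generating function of a centred function `f`. -/
lemma log_mgf_le {ι : Type*} [Fintype ι] [Nonempty ι] {f : ι → ℝ} (hf : ∑ x, f x = 0)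
    {B V T : ℝ} (hT : 0 < T)
    (h : ∀ θ, 0 < θ → θ ≤ T → ent (fun x => Real.exp (θ * f x)) ≤
      θ ^ 2 * (B * ∑ x, f x * Real.exp (θ * f x) + V * ∑ x, Real.exp (θ * f x))) :
    (1 - B * T) * Real.log ((∑ x, Real.exp (T * f x)) / Fintype.card ι) ≤ V * T ^ 2 := by
  have hN : (0 : ℝ) < Fintype.card ι := by exact_mod_cast Fintype.card_pos
  set m : ℝ → ℝ := fun θ => ∑ x, Real.exp (θ * f x) with hm
  set m' : ℝ → ℝ := fun θ => ∑ x, f x * Real.exp (θ * f x) with hm'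
  set L : ℝ → ℝ := fun θ => Real.log (m θ / Fintype.card ι) with hL
  have hmpos : ∀ θ, 0 < m θ :=
    fun θ => Finset.sum_pos (fun x _ => Real.exp_pos _) Finset.univ_nonempty
  have hmd : ∀ θ, HasDerivAt m (m' θ) θ := by
    intro θ
    have : ∀ x ∈ (Finset.univ : Finset ι),
        HasDerivAt (fun θ => Real.exp (θ * f x)) (f x * Real.exp (θ * f x)) θ := by
      intro x _
      have := ((hasDerivAt_id θ).mul_const (f x)).exp
      simpa [mul_comm] using this
    exact HasDerivAt.fun_sum this
  have hLd : ∀ θ, HasDerivAt L (m' θ / m θ) θ := by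
    intro θ
    have h1 := ((hmd θ).div_const (Fintype.card ι : ℝ)).log (div_pos (hmpos θ) hN).ne'
    convert h1 using 1
    field_simp
  have hL0 : L 0 = 0 := by simp [hL, hm]
  have hlim : Tendsto (fun θ => L θ / θ) (𝓝[>] 0) (𝓝 0) := by
    have h1 := (hasDerivAt_iff_tendsto_slope_zero.1 (hLd 0)).mono_left
      (nhdsWithin_mono (0 : ℝ) (fun x (hx : 0 < x) => hx.ne'))
    have h2 : m' 0 = 0 := by simp [hm', hf]
    simp only [zero_add, hL0, sub_zero, h2, zero_div, smul_eq_mul] at h1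
    refine h1.congr fun θ => ?_
    rw [div_eq_inv_mul]
  set H : ℝ → ℝ := fun θ => L θ / θ - B * L θ - V * θ with hH
  have hHlim : Tendsto H (𝓝[>] 0) (𝓝 0) := by
    have h1 : Tendsto (fun θ => B * L θ + V * θ) (𝓝[>] 0) (𝓝 0) := by
      have h2 : ContinuousAt (fun θ => B * L θ + V * θ) 0 :=
        ((hLd 0).continuousAt.const_mul B).add (continuousAt_id.const_mul V)
      have h3 := h2.tendsto
      simp only [hL0, mul_zero, add_zero] at h3
      exact h3.mono_left nhdsWithin_le_nhds
    have h4 := hlim.sub h1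
    simp only [sub_zero] at h4
    refine h4.congr fun θ => ?_
    simp only [hH]; ring
  have hHd : ∀ θ, 0 < θ → HasDerivAt H
      ((m' θ / m θ * θ - L θ) / θ ^ 2 - B * (m' θ / m θ) - V) θ := by
    intro θ hθ
    have h1 := (((hLd θ).div (hasDerivAt_id θ) hθ.ne').sub ((hLd θ).const_mul B)).sub
      ((hasDerivAt_id θ).const_mul V)
    exact h1.congr_deriv (by simp)
  have hanti : AntitoneOn H (Set.Ioc 0 T) := by
    refine antitoneOn_of_deriv_nonpos (convex_Ioc 0 T)
      (fun θ hθ => (hHd θ hθ.1).continuousAt.continuousWithinAt)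
      (fun θ hθ => ?_) (fun θ hθ => ?_)
    · rw [interior_Ioc] at hθ
      exact (hHd θ hθ.1).differentiableAt.differentiableWithinAt
    · rw [interior_Ioc] at hθ
      rw [(hHd θ hθ.1).deriv]
      have h1 := h θ hθ.1 hθ.2.le
      have h2 : ent (fun x => Real.exp (θ * f x)) = θ * m' θ - m θ * L θ := by
        simp only [ent, Real.log_exp, hm', hL, hm, Finset.mul_sum]
        congr 1
        exact Finset.sum_congr rfl fun x _ => by ring
      rw [h2] at h1
      have hθ2 : 0 < θ ^ 2 := pow_pos hθ.1 2
      have h3 : (m' θ / m θ * θ - L θ) / θ ^ 2 - B * (m' θ / m θ) - V =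
          ((θ * m' θ - m θ * L θ) - θ ^ 2 * (B * m' θ + V * m θ)) / (θ ^ 2 * m θ) := by
        have := (hmpos θ).ne'
        have := hθ.1.ne'
        field_simp
        ring
      rw [h3]
      exact div_nonpos_of_nonpos_of_nonneg (by linarith) (by have := hmpos θ; positivity)
  have hHT : H T ≤ 0 := by
    refine ge_of_tendsto hHlim ?_
    filter_upwards [Ioc_mem_nhdsGT hT] with s hs
    exact hanti hs ⟨hT, le_rfl⟩ hs.2
  have h5 : (1 - B * T) * L T - V * T ^ 2 = H T * T := by
    simp only [hH]
    field_simp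
  have h6 : H T * T ≤ 0 := mul_nonpos_of_nonpos_of_nonneg hHT hT.le
  change (1 - B * T) * L T ≤ V * T ^ 2
  linarith

lemma permProb_le_one (n : ℕ) (p : Equiv.Perm (Fin n) → Prop) : permProb n p ≤ 1 := by
  unfold permProb
  refine div_le_one_of_le₀ ?_ (by positivity)
  rw [← Nat.card_eq_fintype_card]
  exact_mod_cast Set.ncard_le_card _

lemma permProb_le_exp {n : ℕ} {p : Equiv.Perm (Fin n) → Prop} {f : Equiv.Perm (Fin n) → ℝ}
    {t θ : ℝ} (hθ : 0 ≤ θ) (hp : ∀ σ, p σ → t ≤ f σ) :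
    permProb n p ≤ Real.exp (-(θ * t) +
      Real.log ((∑ σ, Real.exp (θ * f σ)) / Fintype.card (Equiv.Perm (Fin n)))) := by
  classical
  have hN : (0 : ℝ) < Fintype.card (Equiv.Perm (Fin n)) := by exact_mod_cast Fintype.card_pos
  have hm : 0 < ∑ σ, Real.exp (θ * f σ) :=
    Finset.sum_pos (fun x _ => Real.exp_pos _) Finset.univ_nonempty
  rw [Real.exp_add, Real.exp_log (div_pos hm hN), ← mul_div_assoc]
  unfold permProb
  refine div_le_div_of_nonneg_right ?_ hN.le
  rw [Set.ncard_eq_toFinset_card', Set.toFinset_ofPred, Finset.card_filter, Finset.mul_sum]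
  push_cast
  refine Finset.sum_le_sum fun σ _ => ?_
  rw [← Real.exp_add]
  split_ifs with h
  · exact Real.one_le_exp (by nlinarith [mul_le_mul_of_nonneg_left (hp σ h) hθ])
  · exact (Real.exp_pos _).le

/-- The indicator that `σ` is compatible with every variable of the monomial `m`. -/
def monInd {n : ℕ} (m : Fin n × Fin n →₀ ℕ) (σ : Equiv.Perm (Fin n)) : ℝ :=
  if ∀ p ∈ m.support, σ p.1 = p.2 then 1 else 0

lemma monInd_nonneg {n : ℕ} (m : Fin n × Fin n →₀ ℕ) (σ : Equiv.Perm (Fin n)) :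
    0 ≤ monInd m σ := by
  unfold monInd; split_ifs <;> norm_num

lemma prod_permMat {n : ℕ} (m : Fin n × Fin n →₀ ℕ) (σ : Equiv.Perm (Fin n)) :
    ∏ p ∈ m.support, permMat n σ p ^ m p = monInd m σ := by
  unfold monInd
  split_ifs with h
  · exact Finset.prod_eq_one fun p hp => by simp [permMat, h p hp]
  · push Not at h
    obtain ⟨p, hp, hne⟩ := h
    exact Finset.prod_eq_zero hp (by simpa [permMat, hne] using hp)

lemma permEval_eq_sum {n : ℕ} (φ : MvPolynomial (Fin n × Fin n) ℝ) (σ : Equiv.Perm (Fin n)) :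
    permEval n φ σ = ∑ m ∈ φ.support, φ.coeff m * monInd m σ := by
  unfold permEval
  rw [eval_eq]
  simp_rw [prod_permMat]

open Classical in
/-- The total value at `σ` of the monomials of `φ` containing a variable of row `i`. -/
def rowPart {n : ℕ} (φ : MvPolynomial (Fin n × Fin n) ℝ) (i : Fin n)
    (σ : Equiv.Perm (Fin n)) : ℝ :=
  ∑ m ∈ φ.support, φ.coeff m * (if ∃ p ∈ m.support, p.1 = i then monInd m σ else 0)

lemma rowPart_nonneg {n : ℕ} {φ : MvPolynomial (Fin n × Fin n) ℝ} (hpos : ∀ m, 0 ≤ φ.coeff m)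
    (i : Fin n) (σ : Equiv.Perm (Fin n)) : 0 ≤ rowPart φ i σ := by
  refine Finset.sum_nonneg fun m _ => mul_nonneg (hpos m) ?_
  split_ifs
  exacts [monInd_nonneg _ _, le_rfl]

lemma rowPart_le_permEval {n : ℕ} {φ : MvPolynomial (Fin n × Fin n) ℝ}
    (hpos : ∀ m, 0 ≤ φ.coeff m) (i : Fin n) (σ : Equiv.Perm (Fin n)) :
    rowPart φ i σ ≤ permEval n φ σ := by
  rw [permEval_eq_sum]
  refine Finset.sum_le_sum fun m _ => mul_le_mul_of_nonneg_left ?_ (hpos m)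
  split_ifs
  exacts [le_rfl, monInd_nonneg _ _]

lemma permEval_nonneg {n : ℕ} {φ : MvPolynomial (Fin n × Fin n) ℝ}
    (hpos : ∀ m, 0 ≤ φ.coeff m) (σ : Equiv.Perm (Fin n)) : 0 ≤ permEval n φ σ := by
  rw [permEval_eq_sum]
  exact Finset.sum_nonneg fun m _ => mul_nonneg (hpos m) (monInd_nonneg m σ)

lemma permEval_pderiv {n : ℕ} (φ : MvPolynomial (Fin n × Fin n) ℝ) (p : Fin n × Fin n)
    (σ : Equiv.Perm (Fin n)) :
    permEval n (pderiv p φ) σ =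
      ∑ m ∈ φ.support, φ.coeff m * (m p * monInd (m - Finsupp.single p 1) σ) := by
  unfold permEval
  conv_lhs => rw [φ.as_sum]
  rw [map_sum, map_sum]
  refine Finset.sum_congr rfl fun m _ => ?_
  rw [pderiv_monomial, eval_monomial, Finsupp.prod, prod_permMat, mul_assoc]

lemma rowPart_le_permEval_pderiv {n : ℕ} {φ : MvPolynomial (Fin n × Fin n) ℝ}
    (hpos : ∀ m, 0 ≤ φ.coeff m) (i : Fin n) (σ : Equiv.Perm (Fin n)) :
    rowPart φ i σ ≤ permEval n (pderiv (i, σ i) φ) σ := by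
  rw [permEval_pderiv]
  refine Finset.sum_le_sum fun m _ => mul_le_mul_of_nonneg_left ?_ (hpos m)
  have h0 : 0 ≤ (m (i, σ i) : ℝ) * monInd (m - Finsupp.single (i, σ i) 1) σ :=
    mul_nonneg (Nat.cast_nonneg _) (monInd_nonneg _ _)
  split_ifs with h
  · by_cases hm : ∀ p ∈ m.support, σ p.1 = p.2
    · obtain ⟨p, hp, rfl⟩ := h
      have hpe : (p.1, σ p.1) = p := Prod.ext rfl (hm p hp)
      have h1 : monInd m σ = 1 := if_pos hm
      have h2 : monInd (m - Finsupp.single (p.1, σ p.1) 1) σ = 1 := by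
        refine if_pos fun q hq => hm q ?_
        rw [Finsupp.mem_support_iff, Finsupp.tsub_apply] at hq
        rw [Finsupp.mem_support_iff]
        omega
      rw [h1, h2, mul_one, hpe]
      exact_mod_cast Nat.one_le_iff_ne_zero.2 (Finsupp.mem_support_iff.1 hp)
    · have h1 : monInd m σ = 0 := if_neg hm
      rwa [h1]
  · exact h0

lemma sum_rowPart_le {n d : ℕ} {φ : MvPolynomial (Fin n × Fin n) ℝ}
    (hpos : ∀ m, 0 ≤ φ.coeff m) (hdeg : φ.totalDegree ≤ d) (σ : Equiv.Perm (Fin n)) :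
    ∑ i, rowPart φ i σ ≤ d * permEval n φ σ := by
  classical
  rw [permEval_eq_sum, Finset.mul_sum]
  unfold rowPart
  rw [Finset.sum_comm]
  refine Finset.sum_le_sum fun m hm => ?_
  rw [← Finset.mul_sum, mul_left_comm]
  refine mul_le_mul_of_nonneg_left ?_ (hpos m)
  rw [← Finset.sum_filter, Finset.sum_const, nsmul_eq_mul]
  refine mul_le_mul_of_nonneg_right ?_ (monInd_nonneg m σ)
  have h1 : (Finset.univ.filter fun i => ∃ p ∈ m.support, p.1 = i) = m.support.image Prod.fst := by
    ext i; simp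
  have h2 : m.support.card ≤ ∑ p ∈ m.support, m p := by
    rw [Finset.card_eq_sum_ones]
    exact Finset.sum_le_sum fun p hp =>
      Nat.one_le_iff_ne_zero.2 (Finsupp.mem_support_iff.1 hp)
  have h3 : (m.support.image Prod.fst).card ≤ d :=
    Finset.card_image_le.trans (h2.trans ((le_totalDegree hm).trans hdeg))
  rw [← h1] at h3
  convert (Nat.cast_le (α := ℝ)).2 h3

open Equiv in
lemma permEval_sub_swap_le {n : ℕ} {φ : MvPolynomial (Fin n × Fin n) ℝ}
    (hpos : ∀ m, 0 ≤ φ.coeff m) (σ : Perm (Fin n)) (j l : Fin n) :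
    permEval n φ σ - permEval n φ (swap j l * σ) ≤
      rowPart φ (σ⁻¹ j) σ + rowPart φ (σ⁻¹ l) σ := by
  rw [permEval_eq_sum, permEval_eq_sum, ← Finset.sum_sub_distrib]
  unfold rowPart
  rw [← Finset.sum_add_distrib]
  refine Finset.sum_le_sum fun m _ => ?_
  rw [← mul_sub, ← mul_add]
  refine mul_le_mul_of_nonneg_left ?_ (hpos m)
  have hσ := monInd_nonneg m σ
  have hσ' := monInd_nonneg m (swap j l * σ)
  split_ifs with h1 h2 h2
  · linarith
  · linarith
  · linarith
  · by_cases hm : ∀ p ∈ m.support, σ p.1 = p.2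
    · have h3 : monInd m (swap j l * σ) = 1 := by
        refine if_pos fun p hp => ?_
        push Not at h1 h2
        rw [Perm.mul_apply, swap_apply_of_ne_of_ne]
        · exact hm p hp
        · exact fun h => h1 p hp (Perm.eq_inv_iff_eq.2 h)
        · exact fun h => h2 p hp (Perm.eq_inv_iff_eq.2 h)
      have h4 : monInd m σ = 1 := if_pos hm
      rw [h3, h4]; norm_num
    · have h4 : monInd m σ = 0 := if_neg hm
      rw [h4]; linarith

lemma betaConst_ge {n d : ℕ} (hn : 1 ≤ n) {CD CD' : ℝ} (hCD : 0 ≤ CD) (hCD' : 0 ≤ CD') :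
    9 * (d : ℝ) * min CD CD' ≤ betaConst n d CD CD' := by
  have hn' : (1 : ℝ) ≤ n := by exact_mod_cast hn
  have hn0 : (0 : ℝ) < n := by linarith
  set x : ℝ := 2 / n with hx
  have hxpos : 0 < x := by positivity
  have he : Real.exp (-x) < 1 := Real.exp_lt_one_iff.2 (by linarith)
  have hx1 : 1 - x ≤ Real.exp (-x) := by linarith [Real.add_one_le_exp (-x)]
  have hstuff : 1 ≤ x * (2 - Real.exp (-x)) / (1 - Real.exp (-x)) := by
    rw [le_div_iff₀ (by linarith)]
    nlinarith
  have hbeta : betaConst n d CD CD' = 6 * (d : ℝ) * (CD' *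
      (max 0 (Real.log (4 * CD * n / CD')) +
        x * (2 - Real.exp (-x)) / (1 - Real.exp (-x)))) := by
    unfold betaConst
    rw [neg_div, ← hx]
    ring
  rw [hbeta]
  have hmain : 3 / 2 * min CD CD' ≤ CD' * (max 0 (Real.log (4 * CD * n / CD')) +
      x * (2 - Real.exp (-x)) / (1 - Real.exp (-x))) := by
    rcases le_total (3 / 2 * CD) CD' with h | h
    · calc 3 / 2 * min CD CD' ≤ CD' * 1 := by linarith [min_le_left CD CD']
        _ ≤ _ := by
          gcongr
          linarith [le_max_left 0 (Real.log (4 * CD * n / CD'))]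
    · rcases hCD'.eq_or_lt with h0 | h0
      · rw [← h0, min_eq_right hCD]; simp
      · have hCDp : 0 < CD := by linarith
        have hlog := Real.one_sub_inv_le_log_of_pos
          (show 0 < 4 * CD * n / CD' by positivity)
        have hinv : (4 * CD * n / CD')⁻¹ ≤ 1 / 2 := by
          rw [inv_div, div_le_iff₀ (by positivity)]
          nlinarith
        calc 3 / 2 * min CD CD' ≤ CD' * (1 / 2 + 1) := by linarith [min_le_right CD CD']
          _ ≤ _ := by
            gcongr
            linarith [le_max_right 0 (Real.log (4 * CD * n / CD'))]
  have hd : (0 : ℝ) ≤ 6 * d := by positivity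
  nlinarith [mul_le_mul_of_nonneg_left hmain hd]

lemma exp_mul_sub_le {θ x y : ℝ} (hθ : 0 ≤ θ) (hxy : y ≤ x) :
    (Real.exp (θ * x) - Real.exp (θ * y)) * (θ * x - θ * y) ≤
      1 * θ ^ 2 * (x - y) ^ 2 * Real.exp (θ * x) := by
  have hu : 0 ≤ θ * x - θ * y := by nlinarith
  have h1 : Real.exp (θ * y) = Real.exp (θ * x) * Real.exp (-(θ * x - θ * y)) := by
    rw [← Real.exp_add]; congr 1; ring
  have h2 := Real.add_one_le_exp (-(θ * x - θ * y))
  have h3 := Real.exp_pos (θ * x)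
  have h4 : Real.exp (θ * x) - Real.exp (θ * y) ≤ Real.exp (θ * x) * (θ * x - θ * y) := by
    rw [h1]; nlinarith
  calc _ ≤ Real.exp (θ * x) * (θ * x - θ * y) * (θ * x - θ * y) :=
        mul_le_mul_of_nonneg_right h4 hu
    _ = _ := by ring

lemma exp_neg_mul_sub_le {s x y : ℝ} (hs : 0 ≤ s) (hxy : y ≤ x) (hsmall : s * (x - y) ≤ 1 / 2) :
    (Real.exp (-s * x) - Real.exp (-s * y)) * (-s * x - -s * y) ≤
      3 / 2 * (-s) ^ 2 * (x - y) ^ 2 * Real.exp (-s * x) := by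
  have hu : 0 ≤ s * (x - y) := mul_nonneg hs (by linarith)
  have h1 : Real.exp (-s * y) = Real.exp (-s * x) * Real.exp (s * (x - y)) := by
    rw [← Real.exp_add]; congr 1; ring
  have h2 := (abs_le.1 (Real.abs_exp_sub_one_sub_id_le
    (show |s * (x - y)| ≤ 1 by rw [abs_of_nonneg hu]; linarith))).2
  have h3 := Real.exp_pos (-s * x)
  have h4 : Real.exp (s * (x - y)) - 1 ≤ 3 / 2 * (s * (x - y)) := by nlinarith
  have h5 : Real.exp (-s * y) - Real.exp (-s * x) ≤
      Real.exp (-s * x) * (3 / 2 * (s * (x - y))) := by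
    rw [h1]; nlinarith
  calc _ = (Real.exp (-s * y) - Real.exp (-s * x)) * (s * (x - y)) := by ring
    _ ≤ Real.exp (-s * x) * (3 / 2 * (s * (x - y))) * (s * (x - y)) :=
        mul_le_mul_of_nonneg_right h5 hu
    _ = _ := by ring

lemma upper_tail {n : ℕ} {f : Equiv.Perm (Fin n) → ℝ} (hf : ∑ σ, f σ = 0) {b E β γ t : ℝ}
    (hb : 0 ≤ b) (hE : 0 ≤ E) (hbβ : 9 / 4 * b ≤ β) (hγ : 4 / 3 * (β * E) ≤ γ) (ht : 0 ≤ t)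
    (hent : ∀ θ, 0 < θ → ent (fun σ => Real.exp (θ * f σ)) ≤
      θ ^ 2 * b * ∑ σ, (f σ + E) * Real.exp (θ * f σ)) :
    permProb n (fun σ => t ≤ f σ) ≤ Real.exp (-t ^ 2 / (2 * (γ + β * t))) := by
  have hβ : 0 ≤ β := by linarith
  have hbE : 9 / 4 * (b * E) ≤ β * E := by nlinarith
  have hbE0 : 0 ≤ b * E := mul_nonneg hb hE
  have hγ0 : 0 ≤ γ := by linarith
  have hD0 : 0 ≤ γ + β * t := by positivity
  rcases ht.eq_or_lt with rfl | ht0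
  · simpa using permProb_le_one n _
  rcases hD0.eq_or_lt with hD | hD
  · rw [← hD]; simpa using permProb_le_one n _
  set D := γ + β * t with hDdef
  have hbt : 9 / 4 * (b * t) ≤ β * t := by nlinarith
  have hDb : 0 < D - b * t := by nlinarith
  set θ := t / D with hθ
  have hθ0 : 0 < θ := div_pos ht0 hD
  have hmgf := log_mgf_le (B := b) (V := b * E) hf hθ0 (fun s hs _ => (hent s hs).trans_eq (by
    simp only [add_mul, Finset.sum_add_distrib, ← Finset.mul_sum]; ring))
  set L := Real.log ((∑ σ, Real.exp (θ * f σ)) / Fintype.card (Equiv.Perm (Fin n))) with hL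
  refine (permProb_le_exp hθ0.le (fun σ h => h)).trans (Real.exp_le_exp.2 ?_)
  rw [← hL]
  have hθD : θ * D = t := div_mul_cancel₀ t hD.ne'
  have h1 : (1 - b * θ) * D = D - b * t := by rw [← hθD]; ring
  have h2 : (D - b * t) * L ≤ (D - b * t) * (θ ^ 2 * D / 2) := by
    calc (D - b * t) * L = D * ((1 - b * θ) * L) := by rw [← h1]; ring
      _ ≤ D * (b * E * θ ^ 2) := mul_le_mul_of_nonneg_left hmgf hD.le
      _ = b * E * (θ ^ 2 * D) := by ring
      _ ≤ (D - b * t) / 2 * (θ ^ 2 * D) := by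
          refine mul_le_mul_of_nonneg_right ?_ (by positivity)
          nlinarith
      _ = _ := by ring
  have h3 := le_of_mul_le_mul_left h2 hDb
  have h4 : -t ^ 2 / (2 * D) = -(θ * t) + θ ^ 2 * D / 2 := by
    rw [hθ]; field_simp; ring
  rw [h4]
  linarith

lemma lower_tail {n : ℕ} {f : Equiv.Perm (Fin n) → ℝ} (hf : ∑ σ, f σ = 0) {b E β γ t M : ℝ}
    (hb : 0 ≤ b) (hE : 0 ≤ E) (hbβ : 9 / 4 * b ≤ β) (hMβ : 9 * M ≤ β)
    (hγ : 4 / 3 * (β * E) ≤ γ) (ht : 0 ≤ t) (hfE : ∀ σ, -E ≤ f σ)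
    (hent : ∀ s, 0 < s → s * (2 * M) ≤ 1 / 2 → ent (fun σ => Real.exp (-s * f σ)) ≤
      s ^ 2 * (3 / 2 * b) * ∑ σ, (f σ + E) * Real.exp (-s * f σ)) :
    permProb n (fun σ => f σ ≤ -t) ≤ Real.exp (-t ^ 2 / (2 * γ)) := by
  have hβ : 0 ≤ β := by linarith
  have hbE : 9 / 4 * (b * E) ≤ β * E := by nlinarith
  have hbE0 : 0 ≤ b * E := mul_nonneg hb hE
  have hγ0 : 0 ≤ γ := by linarith
  rcases ht.eq_or_lt with rfl | ht0
  · simpa using permProb_le_one n _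
  rcases hγ0.eq_or_lt with hγz | hγp
  · rw [← hγz]; simpa using permProb_le_one n _
  rcases lt_or_ge E t with htE | htE
  · have : {σ : Equiv.Perm (Fin n) | f σ ≤ -t} = ∅ := by
      ext σ
      simp only [Set.mem_ofPred_eq, Set.mem_empty_iff_false, iff_false, not_le]
      linarith [hfE σ]
    unfold permProb
    rw [this]
    simpa using (Real.exp_pos _).le
  set s := t / γ with hs
  have hs0 : 0 < s := div_pos ht0 hγp
  have hsγ : s * γ = t := div_mul_cancel₀ t hγp.ne'
  have hEpos : 0 < E := by linarith
  have hsβ : s * β ≤ 3 / 4 := by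
    have h1 : s * β * E ≤ 3 / 4 * E := by nlinarith [mul_le_mul_of_nonneg_left hγ hs0.le]
    exact le_of_mul_le_mul_right h1 hEpos
  have hsM : s * (2 * M) ≤ 1 / 2 := by nlinarith [mul_le_mul_of_nonneg_left hMβ hs0.le]
  have hneg : ∀ r σ, r * (-f σ) = -r * f σ := fun r σ => by ring
  have hmgf := log_mgf_le (f := fun σ => -f σ) (B := 0) (V := 3 / 2 * (b * E))
    (by rw [Finset.sum_neg_distrib, hf, neg_zero]) hs0 (fun r hr hrs => by
      simp only [hneg]
      have hrM : r * (2 * M) ≤ 1 / 2 := by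
        rcases le_total 0 M with hM | hM
        · exact (mul_le_mul_of_nonneg_right hrs (by linarith)).trans hsM
        · nlinarith
      refine (hent r hr hrM).trans ?_
      have hassoc : ∑ σ, f σ * Real.exp (-r * f σ) ≤ 0 := by
        rw [← hf]
        refine Finset.sum_le_sum fun σ _ => ?_
        rcases le_total 0 (f σ) with h | h
        · have : Real.exp (-r * f σ) ≤ 1 := Real.exp_le_one_iff.2 (by nlinarith)
          nlinarith
        · have : 1 ≤ Real.exp (-r * f σ) := Real.one_le_exp (by nlinarith)
          nlinarith
      simp only [add_mul, Finset.sum_add_distrib, ← Finset.mul_sum, zero_mul, zero_add]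
      have := mul_le_mul_of_nonneg_left hassoc (show 0 ≤ r ^ 2 * (3 / 2 * b) by positivity)
      linarith)
  refine (permProb_le_exp (f := fun σ => -f σ) hs0.le (fun σ h => le_neg_of_le_neg h)).trans
    (Real.exp_le_exp.2 ?_)
  have h4 : -t ^ 2 / (2 * γ) = -(s * t) + γ / 2 * s ^ 2 := by
    rw [hs]; field_simp; ring
  rw [h4]
  have h5 : 3 / 2 * (b * E) * s ^ 2 ≤ γ / 2 * s ^ 2 :=
    mul_le_mul_of_nonneg_right (by linarith) (by positivity)
  rw [zero_mul, sub_zero, one_mul] at hmgf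
  linarith

/-- Theorem 1.2: concentration for low-degree functions on the symmetric group. -/
theorem concentration_low_degree (n d : ℕ) (hn : 1 ≤ n) (hd1 : 1 ≤ d) (hdn : d ≤ n)
    (φ : MvPolynomial (Fin n × Fin n) ℝ)
    (hml : IsMultilinear n φ) (hdeg : φ.totalDegree ≤ d)
    (hpos : ∀ m, 0 ≤ φ.coeff m)
    (CD CD' CU : ℝ) (hCD : 0 ≤ CD) (hCD' : 0 ≤ CD') (hCU : 0 ≤ CU)
    (hD : ∀ k ≤ d, ∀ σ, |permEval n ((Dop n)^[k] φ) σ| ≤ CD)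
    (hDgrad : ∀ k ≤ d, ∀ σ, ∀ q : Fin n × Fin n,
      |permEval n (pderiv q ((Dop n)^[k] φ)) σ| ≤ CD')
    (hDU : ∀ k ≤ d, ∀ σ, |permEval n ((Dop n)^[k] (Uop n φ)) σ| ≤ CU)
    (t : ℝ) (ht : 0 ≤ t) :
    permProb n (fun σ => t ≤ permEval n φ σ - permExp n φ) ≤
      Real.exp (-t ^ 2 /
        (2 * (gammaConst n d CD CD' CU (permExp n φ) + betaConst n d CD CD' * t))) ∧
    permProb n (fun σ => permEval n φ σ - permExp n φ ≤ -t) ≤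
      Real.exp (-t ^ 2 / (2 * gammaConst n d CD CD' CU (permExp n φ))) := by
  have hcard : (0 : ℝ) < Fintype.card (Equiv.Perm (Fin n)) := by exact_mod_cast Fintype.card_pos
  set E := permExp n φ with hE
  have hE0 : 0 ≤ E := div_nonneg (Finset.sum_nonneg fun σ _ => permEval_nonneg hpos σ) hcard.le
  set M := min CD CD' with hM
  have hM0 : 0 ≤ M := le_min hCD hCD'
  have hQM : ∀ i σ, rowPart φ i σ ≤ M := fun i σ => le_min
    ((rowPart_le_permEval hpos i σ).trans ((le_abs_self _).trans (hD 0 (Nat.zero_le d) σ)))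
    ((rowPart_le_permEval_pderiv hpos i σ).trans
      ((le_abs_self _).trans (hDgrad 0 (Nat.zero_le d) σ _)))
  have hβ := betaConst_ge (d := d) hn hCD hCD'
  rw [← hM] at hβ
  set β := betaConst n d CD CD' with hβdef
  have hd : (1 : ℝ) ≤ d := by exact_mod_cast hd1
  have hb : 0 ≤ 4 * (d : ℝ) * M := by positivity
  have hbβ : 9 / 4 * (4 * (d : ℝ) * M) ≤ β := by linarith
  have hβ0 : 0 ≤ β := by linarith
  have hγ : 4 / 3 * (β * E) ≤ gammaConst n d CD CD' CU E := by
    unfold gammaConst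
    rw [← hβdef]
    nlinarith [mul_nonneg hβ0 hCU]
  set f : Equiv.Perm (Fin n) → ℝ := fun σ => permEval n φ σ - E with hf
  have hf0 : ∑ σ, f σ = 0 := by
    simp only [hf, Finset.sum_sub_distrib, Finset.sum_const, Finset.card_univ, nsmul_eq_mul]
    rw [hE, permExp, mul_div_cancel₀ _ hcard.ne', sub_self]
  have hfE : ∀ σ, f σ + E = permEval n φ σ := fun σ => by simp [hf]
  have hdiff : ∀ σ j l, f σ - f (Equiv.swap j l * σ) ≤
      rowPart φ (σ⁻¹ j) σ + rowPart φ (σ⁻¹ l) σ := fun σ j l => by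
    simpa [hf] using permEval_sub_swap_le hpos σ j l
  have hent : ∀ κ θ : ℝ, 0 ≤ κ → (∀ x y, y ≤ x → x - y ≤ 2 * M →
      (Real.exp (θ * x) - Real.exp (θ * y)) * (θ * x - θ * y) ≤
        κ * θ ^ 2 * (x - y) ^ 2 * Real.exp (θ * x)) → _ := fun κ θ hκ hexp =>
    ent_exp_le (f := f) (F := fun σ => f σ + E) (d := d) hn hM0 hκ (rowPart_nonneg hpos) hQM
      (fun σ => (sum_rowPart_le hpos hdeg σ).trans_eq (by simp only [hfE])) hdiff hexp
  constructor
  · refine upper_tail hf0 hb hE0 hbβ hγ ht fun θ hθ => ?_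
    refine (hent 1 θ zero_le_one fun x y hxy _ => exp_mul_sub_le hθ.le hxy).trans_eq ?_
    ring
  · refine lower_tail (M := M) hf0 hb hE0 hbβ (by nlinarith) hγ ht
      (fun σ => by linarith [hfE σ, permEval_nonneg hpos σ]) fun s hs hsM => ?_
    refine (hent (3 / 2) (-s) (by norm_num) fun x y hxy hle => exp_neg_mul_sub_le hs.le hxy
      ((mul_le_mul_of_nonneg_left hle hs.le).trans hsM)).trans_eq ?_
    ring
end
end

section
/- Variance bound for additive functionals of (M1)-processes via the pseudo spectral gap: Let S be countable and E a Polish space, and let (Y_k,Z_k)_{k≥0} satisfy property (M1). Suppose Y is irreducible and positive recurrent with stationary probability μ and pseudo spectral gap γ_ps > 0. Let (f_i)_{i≥1} be functions f_i : S×E → ℝ with sup_{u∈S} E_u[f_i(Y_1,Z_1)²] < ∞ for each i. Then for all k ≥ 1, under P_μ (that is, with Y_0 distributed according to μ): Var[ Σ_{i=1}^{k} f_i(Y_i,Z_i) ] ≤ (6/γ_ps) · Σ_{i=1}^{k} Var_μ[f_i(Y_1,Z_1)], where Var_μ denotes variance under P_μ. -/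
open MeasureTheory Filter
open scoped ENNReal Classical

noncomputable section

/-- `k`-step transition probabilities of the Markov chain with one-step kernel `Q`. -/
noncomputable def Qpow {S : Type*} (Q : S → S → ℝ≥0∞) : ℕ → S → S → ℝ≥0∞
  | 0 => fun x y => if x = y then 1 else 0
  | k + 1 => fun x y => ∑' z, Q x z * Qpow Q k z y

/-- Irreducibility of the Markov chain with kernel `Q`. -/
def ChainIrreducible {S : Type*} (Q : S → S → ℝ≥0∞) : Prop :=
  ∀ x y, ∃ k, Qpow Q k x y ≠ 0

/-- `π` is a stationary probability distribution for the kernel `Q`. -/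
def IsStationaryDist {S : Type*} (Q : S → S → ℝ≥0∞) (π : S → ℝ≥0∞) : Prop :=
  (∑' x, π x = 1) ∧ ∀ y, ∑' x, π x * Q x y = π y

/-- The orthogonal complement of the constant functions in `ℓ²(ν) = L²(ν)`. -/
noncomputable def constOrthoCompl (S : Type*) [MeasurableSpace S] (ν : Measure S)
    [IsFiniteMeasure ν] : Submodule ℝ (Lp ℝ 2 ν) :=
  (Submodule.span ℝ {MeasureTheory.Lp.const 2 ν (1 : ℝ)})ᗮ

/-- The absolute spectral gap `γ(K)` of a self-adjoint Markov contraction `K`: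
`1 −` the supremum of `|λ|` over the spectrum of the restriction `Kres` of `K`
to the orthogonal complement of the constants, provided `1` is a simple
eigenvalue of `K`, and `0` otherwise. -/
noncomputable def absGapWithRes {H V : Type*} [NormedAddCommGroup H]
    [InnerProductSpace ℝ H] [NormedAddCommGroup V] [NormedSpace ℝ V]
    (K : H →L[ℝ] H) (Kres : V →L[ℝ] V) : ℝ :=
  if ∃ v : H, v ≠ 0 ∧
      Module.End.eigenspace (K : H →ₗ[ℝ] H) 1 = Submodule.span ℝ {v} then
    1 - sSup {r : ℝ | ∃ l ∈ spectrum ℝ Kres, r = |l|}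
  else 0

section MarkovAdditive

open ProbabilityTheory

section Spectral

/-- The norm of a self-adjoint operator on a real Hilbert space is bounded by the supremum of
the absolute values of its spectrum. -/
theorem norm_le_sSup_abs_spectrum {V : Type*} [NormedAddCommGroup V] [InnerProductSpace ℝ V]
    [CompleteSpace V] {T : V →L[ℝ] V} (hT : IsSelfAdjoint T) :
    ‖T‖ ≤ sSup {r : ℝ | ∃ l ∈ spectrum ℝ T, r = |l|} := by
  rcases subsingleton_or_nontrivial V with hV | hV
  · have : T = 0 := Subsingleton.elim _ _
    rw [this, norm_zero]
    exact Real.sSup_nonneg (by rintro r ⟨l, -, rfl⟩; exact abs_nonneg l)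
  have hbdd : BddAbove {r : ℝ | ∃ l ∈ spectrum ℝ T, r = |l|} := by
    refine ⟨‖T‖, ?_⟩
    rintro r ⟨l, hl, rfl⟩
    exact spectrum.norm_le_norm_of_mem hl
  set s := sSup {r : ℝ | ∃ l ∈ spectrum ℝ T, r = |l|} with hs
  have hs0 : 0 ≤ s := Real.sSup_nonneg (by rintro r ⟨l, -, rfl⟩; exact abs_nonneg l)
  have h1 : spectralRadius ℝ T ≤ ENNReal.ofReal s := by
    refine iSup₂_le fun l hl => ?_
    have : ‖l‖ ≤ s := le_csSup hbdd ⟨l, hl, rfl⟩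
    rw [← enorm_eq_nnnorm, ← ofReal_norm]
    exact ENNReal.ofReal_le_ofReal this
  rw [ContinuousLinearMap.spectralRadius_eq_nnnorm T hT, ← enorm_eq_nnnorm,
    ← ofReal_norm] at h1
  exact (ENNReal.ofReal_le_ofReal_iff hs0).1 h1

theorem absGapWithRes_le_one {H V : Type*} [NormedAddCommGroup H]
    [InnerProductSpace ℝ H] [NormedAddCommGroup V] [NormedSpace ℝ V]
    (K : H →L[ℝ] H) (Kres : V →L[ℝ] V) : absGapWithRes K Kres ≤ 1 := by
  unfold absGapWithRes
  split_ifs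
  · have : 0 ≤ sSup {r : ℝ | ∃ l ∈ spectrum ℝ Kres, r = |l|} :=
      Real.sSup_nonneg (by rintro r ⟨l, -, rfl⟩; exact abs_nonneg l)
    linarith
  · exact zero_le_one

/-- A positive absolute spectral gap of `A† A` makes `A` a strict contraction on an invariant
subspace on which the gap is computed. -/
theorem norm_sq_le_of_absGapWithRes_pos {H : Type*} [NormedAddCommGroup H]
    [InnerProductSpace ℝ H] [CompleteSpace H] (A : H →L[ℝ] H) (W : Submodule ℝ H)
    [CompleteSpace W] (R : W →L[ℝ] W)
    (hR : ∀ v : W, (R v : H) = (ContinuousLinearMap.adjoint A * A) (v : H))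
    (hg : 0 < absGapWithRes (ContinuousLinearMap.adjoint A * A) R) (v : W) :
    ‖A v‖ ^ 2 ≤ (1 - absGapWithRes (ContinuousLinearMap.adjoint A * A) R) * ‖(v : H)‖ ^ 2 := by
  have hsa : IsSelfAdjoint R := by
    rw [ContinuousLinearMap.isSelfAdjoint_iff_isSymmetric]
    intro x y
    change inner ℝ ((R x : W) : H) (y : H) = inner ℝ (x : H) ((R y : W) : H)
    rw [hR, hR]
    simp [ContinuousLinearMap.adjoint_inner_left, ContinuousLinearMap.adjoint_inner_right]
  have hn := norm_le_sSup_abs_spectrum hsa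
  have he : ‖A v‖ ^ 2 = inner ℝ (R v) v := by
    change _ = inner ℝ ((R v : W) : H) (v : H)
    rw [hR]
    simp [ContinuousLinearMap.adjoint_inner_left]
  have hb : 1 - absGapWithRes (ContinuousLinearMap.adjoint A * A) R
      = sSup {r : ℝ | ∃ l ∈ spectrum ℝ R, r = |l|} := by
    unfold absGapWithRes at hg ⊢
    split_ifs at hg ⊢
    · ring
    · exact absurd hg (lt_irrefl 0)
  rw [hb, he]
  calc inner ℝ (R v) v ≤ ‖R v‖ * ‖v‖ := real_inner_le_norm _ _
    _ ≤ (‖R‖ * ‖v‖) * ‖v‖ := by gcongr; exact R.le_opNorm v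
    _ = ‖R‖ * ‖(v : H)‖ ^ 2 := by rw [Submodule.coe_norm]; ring
    _ ≤ _ := by gcongr

end Spectral

section Combinatorics

theorem one_sub_mul_sum_pow_div_le {q : ℝ} (hq : 0 ≤ q) {m : ℕ} (hm : 0 < m)
    (n : ℕ) : (1 - q) * ∑ d ∈ Finset.range n, q ^ (d / m) ≤ m := by
  have h1 : ∑ d ∈ Finset.range n, q ^ (d / m) ≤ ∑ d ∈ Finset.range (m + n), q ^ (d / m) :=
    Finset.sum_le_sum_of_subset_of_nonneg (Finset.range_mono (by omega))
      fun _ _ _ => pow_nonneg hq _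
  have h2 : ∑ d ∈ Finset.range (m + n), q ^ (d / m)
      = m + q * ∑ d ∈ Finset.range n, q ^ (d / m) := by
    rw [Finset.sum_range_add, Finset.mul_sum]
    congr 1
    · rw [Finset.sum_congr rfl fun d hd => by
        rw [Nat.div_eq_of_lt (Finset.mem_range.1 hd), pow_zero]]
      simp
    · refine Finset.sum_congr rfl fun d _ => ?_
      rw [Nat.add_div_left _ hm, pow_succ']
  linarith

theorem sum_Icc_ite_dist_le {r : ℕ → ℝ} (hr : ∀ d, 0 ≤ r d) {k i : ℕ}
    (hi : i ∈ Finset.Icc 1 k) :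
    ∑ j ∈ Finset.Icc 1 k, (if i = j then 1 else r (Nat.dist i j - 1))
      ≤ 1 + 2 * ∑ d ∈ Finset.range k, r d := by
  rw [Finset.mem_Icc] at hi
  have key : ∀ j ∈ Finset.Icc 1 k, (if i = j then 1 else r (Nat.dist i j - 1)) =
      (if j = i then 1 else 0) + ((if j < i then r (i - j - 1) else 0)
        + if i < j then r (j - i - 1) else 0) := by
    intro j _
    rcases lt_trichotomy i j with h | h | h
    · simp [h, h.ne, h.ne', not_lt_of_gt h, Nat.dist_eq_sub_of_le h.le]
    · simp [h]
    · simp [h, h.ne, h.ne', not_lt_of_gt h, Nat.dist_eq_sub_of_le_right h.le]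
  rw [Finset.sum_congr rfl key, Finset.sum_add_distrib, Finset.sum_add_distrib, two_mul,
    Finset.sum_ite_eq', if_pos (Finset.mem_Icc.2 hi), ← Finset.sum_filter, ← Finset.sum_filter]
  have hle : ∀ (s : Finset ℕ) (g : ℕ → ℕ), Set.InjOn g s → (∀ j ∈ s, g j < k) →
      ∑ j ∈ s, r (g j) ≤ ∑ d ∈ Finset.range k, r d := by
    intro s g hg hk
    rw [← Finset.sum_image (f := r) (g := g) hg]
    refine Finset.sum_le_sum_of_subset_of_nonneg ?_ fun _ _ _ => hr _
    intro d hd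
    obtain ⟨j, hj, rfl⟩ := Finset.mem_image.1 hd
    exact Finset.mem_range.2 (hk j hj)
  gcongr
  · refine hle _ (fun j => i - j - 1) ?_ ?_
    · intro a ha b hb hab
      simp at ha hb hab
      omega
    · intro j hj
      simp at hj
      omega
  · refine hle _ (fun j => j - i - 1) ?_ ?_
    · intro a ha b hb hab
      simp at ha hb hab
      omega
    · intro j hj
      simp at hj
      omega

/-- A double sum whose terms decay with the distance of the indices is controlled by its
diagonal. -/
theorem sum_sum_le_of_decay {r : ℕ → ℝ} (hr : ∀ d, 0 ≤ r d) {a : ℕ → ℝ} (ha : ∀ i, 0 ≤ a i)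
    {c : ℕ → ℕ → ℝ} {k : ℕ}
    (hc : ∀ i ∈ Finset.Icc 1 k, ∀ j ∈ Finset.Icc 1 k,
      c i j ≤ (if i = j then 1 else r (Nat.dist i j - 1)) * ((a i + a j) / 2)) :
    ∑ i ∈ Finset.Icc 1 k, ∑ j ∈ Finset.Icc 1 k, c i j
      ≤ (1 + 2 * ∑ d ∈ Finset.range k, r d) * ∑ i ∈ Finset.Icc 1 k, a i := by
  set w : ℕ → ℕ → ℝ := fun i j => if i = j then 1 else r (Nat.dist i j - 1) with hw
  have hsymm : ∀ i j, w i j = w j i := fun i j => by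
    simp only [hw, eq_comm (a := i), Nat.dist_comm i]
  calc ∑ i ∈ Finset.Icc 1 k, ∑ j ∈ Finset.Icc 1 k, c i j
      ≤ ∑ i ∈ Finset.Icc 1 k, ∑ j ∈ Finset.Icc 1 k, (w i j * (a i / 2) + w i j * (a j / 2)) := by
        refine Finset.sum_le_sum fun i hi => Finset.sum_le_sum fun j hj => ?_
        refine (hc i hi j hj).trans (le_of_eq ?_)
        simp only [hw]
        ring
    _ = ∑ i ∈ Finset.Icc 1 k, (∑ j ∈ Finset.Icc 1 k, w i j) * a i := by
        simp_rw [Finset.sum_add_distrib]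
        rw [Finset.sum_comm (f := fun i j => w i j * (a j / 2)), ← Finset.sum_add_distrib]
        refine Finset.sum_congr rfl fun i _ => ?_
        rw [Finset.sum_mul, ← Finset.sum_add_distrib]
        refine Finset.sum_congr rfl fun j _ => ?_
        rw [hsymm j i]
        ring
    _ ≤ _ := by
        rw [Finset.mul_sum]
        refine Finset.sum_le_sum fun i hi => ?_
        exact mul_le_mul_of_nonneg_right (sum_Icc_ite_dist_le hr hi) (ha i)

end Combinatorics

theorem sq_integral_mul_le {Ω : Type*} [MeasurableSpace Ω] {μ : Measure Ω} {X H : Ω → ℝ}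
    (hX : MemLp X 2 μ) (hH : MemLp H 2 μ) :
    (∫ ω, X ω * H ω ∂μ) ^ 2 ≤ (∫ ω, X ω ^ 2 ∂μ) * ∫ ω, H ω ^ 2 ∂μ := by
  have hXH : Integrable (fun ω => X ω * H ω) μ := hX.integrable_mul hH
  have h := discrim_le_zero (a := ∫ ω, X ω ^ 2 ∂μ) (b := 2 * ∫ ω, X ω * H ω ∂μ)
    (c := ∫ ω, H ω ^ 2 ∂μ) fun t => by
      have : 0 ≤ ∫ ω, (t * X ω + H ω) ^ 2 ∂μ := integral_nonneg fun _ => sq_nonneg _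
      have he : ∫ ω, (t * X ω + H ω) ^ 2 ∂μ = (∫ ω, X ω ^ 2 ∂μ) * (t * t)
          + (2 * ∫ ω, X ω * H ω ∂μ) * t + ∫ ω, H ω ^ 2 ∂μ := by
        have e : (fun ω => (t * X ω + H ω) ^ 2)
            = fun ω => (t * t) * X ω ^ 2 + (2 * t) * (X ω * H ω) + H ω ^ 2 := by
          funext ω
          ring
        have h1 : Integrable (fun ω => (t * t) * X ω ^ 2) μ := hX.integrable_sq.const_mul _
        have h2 : Integrable (fun ω => (2 * t) * (X ω * H ω)) μ := hXH.const_mul _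
        have h12 : Integrable (fun ω => (t * t) * X ω ^ 2 + (2 * t) * (X ω * H ω)) μ :=
          h1.add h2
        rw [e, integral_add h12 hH.integrable_sq, integral_add h1 h2,
          integral_const_mul, integral_const_mul]
        ring
      linarith
  rw [discrim] at h
  linarith

theorem sq_integral_le_integral_sq {Ω : Type*} [MeasurableSpace Ω] {μ : Measure Ω}
    [IsProbabilityMeasure μ] {X : Ω → ℝ} (hX : MemLp X 2 μ) :
    (∫ ω, X ω ∂μ) ^ 2 ≤ ∫ ω, X ω ^ 2 ∂μ := by
  simpa using sq_integral_mul_le hX (memLp_const (1 : ℝ))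

section Kernel

variable {S E : Type*} [MeasurableSpace S] [MeasurableSpace E]

theorem memLp_two_of_lintegral_ne_top {α : Type*} [MeasurableSpace α] {μ : Measure α}
    {g : α → ℝ} (hg : Measurable g)
    (h : ∫⁻ p, ENNReal.ofReal (g p ^ 2) ∂μ ≠ ⊤) : MemLp g 2 μ := by
  rw [memLp_two_iff_integrable_sq hg.aestronglyMeasurable]
  exact (lintegral_ofReal_ne_top_iff_integrable (hg.pow_const 2).aestronglyMeasurable
    (ae_of_all _ fun _ => sq_nonneg _)).1 h

theorem integral_measure_comp {α β : Type*} [MeasurableSpace α] [MeasurableSpace β]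
    {κ : Kernel α β} {ν : Measure α} {g : β → ℝ}
    (hg : Integrable g (ν.bind κ)) : ∫ p, g p ∂(ν.bind κ) = ∫ x, ∫ p, g p ∂κ x ∂ν := by
  rw [Measure.comp_eq_comp_const_apply] at hg ⊢
  rw [Kernel.integral_comp hg, Kernel.const_apply]

theorem integrable_integral_kernel {α β : Type*} [MeasurableSpace α] [MeasurableSpace β]
    {κ : Kernel α β} {ν : Measure α} {g : β → ℝ}
    (hg : Integrable g (ν.bind κ)) : Integrable (fun x => ∫ p, g p ∂κ x) ν := by
  rw [Measure.comp_eq_comp_const_apply] at hg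
  simpa using hg.integral_comp

theorem measurable_integral_kernel {α β : Type*} [MeasurableSpace α] [MeasurableSpace β]
    {κ : Kernel α β} [IsMarkovKernel κ] {g : β → ℝ} (hg : Measurable g) :
    Measurable fun x => ∫ p, g p ∂κ x :=
  (hg.stronglyMeasurable.integral_kernel (κ := κ)).measurable

theorem integral_sq_integral_kernel_le {α β : Type*} [MeasurableSpace α] [MeasurableSpace β]
    {κ : Kernel α β} [IsMarkovKernel κ] {ν : Measure α} {g : β → ℝ} (hgm : Measurable g)
    (hg : MemLp g 2 (ν.bind κ)) :
    ∫ x, (∫ p, g p ∂κ x) ^ 2 ∂ν ≤ ∫ p, g p ^ 2 ∂(ν.bind κ) := by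
  rw [integral_measure_comp hg.integrable_sq]
  refine integral_mono_of_nonneg (ae_of_all _ fun _ => sq_nonneg _)
    (integrable_integral_kernel hg.integrable_sq) ?_
  filter_upwards [Measure.ae_integrable_of_integrable_comp hg.integrable_sq] with x hx
  exact sq_integral_le_integral_sq
    ((memLp_two_iff_integrable_sq hgm.aestronglyMeasurable).2 hx)

theorem mem_constOrthoCompl_of_integral_eq_zero {ν : Measure S} [IsProbabilityMeasure ν]
    {h : S → ℝ} (hh : MemLp h 2 ν) (h0 : ∫ x, h x ∂ν = 0) : hh.toLp h ∈ constOrthoCompl S ν := by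
  rw [constOrthoCompl, Submodule.mem_orthogonal_singleton_iff_inner_right, L2.inner_def]
  rw [← h0]
  refine integral_congr_ae ?_
  filter_upwards [hh.coeFn_toLp] with x hx
  simp [hx]

theorem norm_sq_eq_integral_of_ae_eq {α : Type*} [MeasurableSpace α] {ν : Measure α}
    {h : α → ℝ} {v : Lp ℝ 2 ν} (hv : v =ᵐ[ν] h) : ‖v‖ ^ 2 = ∫ x, h x ^ 2 ∂ν := by
  rw [← real_inner_self_eq_norm_sq, L2.inner_def]
  refine integral_congr_ae ?_
  filter_upwards [hv] with x hx
  simp [hx, pow_two]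

/-- The Markov operator on functions of the first coordinate. -/
def stepMean (κ : Kernel S (S × E)) (h : S → ℝ) (x : S) : ℝ := ∫ p, h p.1 ∂κ x

variable {κ : Kernel S (S × E)} {ν : Measure S}

theorem abs_stepMean_le [IsMarkovKernel κ] {h : S → ℝ} {C : ℝ} (hC : ∀ x, |h x| ≤ C) (x : S) :
    |stepMean κ h x| ≤ C := by
  simpa [stepMean] using norm_integral_le_of_norm_le_const (μ := κ x) (f := fun p : S × E => h p.1)
    (C := C) (ae_of_all _ fun p => hC p.1)

theorem abs_stepMean_iterate_le [IsMarkovKernel κ] {h : S → ℝ} {C : ℝ} (hC : ∀ x, |h x| ≤ C)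
    (n : ℕ) (x : S) : |(stepMean κ)^[n] h x| ≤ C := by
  induction n generalizing h with
  | zero => exact hC x
  | succ n ih => exact ih (abs_stepMean_le hC)

variable [Countable S] [MeasurableSingletonClass S]

theorem memLp_two_of_bounded [IsFiniteMeasure ν] {h : S → ℝ} {C : ℝ} (hC : ∀ x, |h x| ≤ C) :
    MemLp h 2 ν :=
  MemLp.of_bound Measurable.of_discrete.aestronglyMeasurable C (ae_of_all _ hC)

theorem memLp_two_fst_of_invariant [IsFiniteMeasure ν]
    (hinv : (ν.bind κ).map Prod.fst = ν) {h : S → ℝ}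
    {C : ℝ} (hC : ∀ x, |h x| ≤ C) :
    MemLp (fun p : S × E => h p.1) 2 (ν.bind κ) := by
  have : MemLp h 2 ((ν.bind κ).map Prod.fst) := by
    rw [hinv]
    exact memLp_two_of_bounded hC
  exact (memLp_map_measure_iff Measurable.of_discrete.aestronglyMeasurable
    measurable_fst.aemeasurable).1 this

theorem integral_fst_of_invariant
    (hinv : (ν.bind κ).map Prod.fst = ν) (h : S → ℝ) :
    ∫ p, h p.1 ∂(ν.bind κ) = ∫ x, h x ∂ν := by
  rw [← integral_map measurable_fst.aemeasurable Measurable.of_discrete.aestronglyMeasurable, hinv]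

variable [IsMarkovKernel κ]

theorem tsum_eq_stepMean {h : S → ℝ} {C : ℝ} (hC : ∀ x, |h x| ≤ C) (x : S) :
    ∑' y, (κ x {p | p.1 = y}).toReal * h y = stepMean κ h x := by
  have hm : IsProbabilityMeasure ((κ x).map Prod.fst) :=
    Measure.isProbabilityMeasure_map measurable_fst.aemeasurable
  rw [stepMean, ← integral_map measurable_fst.aemeasurable
    Measurable.of_discrete.aestronglyMeasurable,
    integral_countable ((memLp_two_of_bounded hC).integrable one_le_two)]
  refine tsum_congr fun y => ?_
  rw [smul_eq_mul, Measure.real, Measure.map_apply measurable_fst (measurableSet_singleton y)]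
  rfl

theorem operator_pow_ae_eq_stepMean_iterate (hinv : (ν.bind κ).map Prod.fst = ν)
    {Qop : Lp ℝ 2 ν →L[ℝ] Lp ℝ 2 ν}
    (hQop : ∀ f : Lp ℝ 2 ν,
      (Qop f : Lp ℝ 2 ν) =ᵐ[ν] fun x => ∑' y, (κ x {p | p.1 = y}).toReal * f y)
    {h : S → ℝ} {C : ℝ} (hC : ∀ x, |h x| ≤ C) (n : ℕ) (v : Lp ℝ 2 ν) (hv : v =ᵐ[ν] h) :
    ((Qop ^ n) v : Lp ℝ 2 ν) =ᵐ[ν] (stepMean κ)^[n] h := by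
  induction n generalizing h v with
  | zero => simpa using hv
  | succ n ih =>
    rw [pow_succ, Function.iterate_succ_apply]
    refine ih (abs_stepMean_le hC) (Qop v) ((hQop v).trans ?_)
    have h1 : ∀ᵐ x ∂ν, ∀ᵐ p ∂κ x, v p.1 = h p.1 := by
      refine Measure.ae_ae_of_ae_comp (p := fun p : S × E => v p.1 = h p.1) ?_
      have hv' : ∀ᵐ x ∂((ν.bind κ).map Prod.fst), v x = h x := by
        rw [hinv]
        exact hv
      exact ae_of_ae_map measurable_fst.aemeasurable hv'
    filter_upwards [h1] with x hx
    rw [← tsum_eq_stepMean hC]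
    refine tsum_congr fun y => ?_
    by_cases hy : v y = h y
    · rw [hy]
    · have : κ x {p | p.1 = y} = 0 :=
        measure_mono_null (fun p (hp : p.1 = y) => by simpa [hp] using hy) (ae_iff.1 hx)
      simp [this]

variable [IsProbabilityMeasure ν]

theorem integral_stepMean_iterate (hinv : (ν.bind κ).map Prod.fst = ν) {h : S → ℝ}
    {C : ℝ} (hC : ∀ x, |h x| ≤ C) (n : ℕ) :
    ∫ x, (stepMean κ)^[n] h x ∂ν = ∫ x, h x ∂ν := by
  induction n generalizing h with
  | zero => rfl
  | succ n ih =>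
    rw [Function.iterate_succ_apply, ih (abs_stepMean_le hC), ← integral_fst_of_invariant hinv h]
    exact (integral_measure_comp
      ((memLp_two_fst_of_invariant hinv hC).integrable one_le_two)).symm

theorem integral_sq_stepMean_iterate_le (hinv : (ν.bind κ).map Prod.fst = ν) {h : S → ℝ}
    {C : ℝ} (hC : ∀ x, |h x| ≤ C) (n : ℕ) :
    ∫ x, (stepMean κ)^[n] h x ^ 2 ∂ν ≤ ∫ x, h x ^ 2 ∂ν := by
  induction n generalizing h with
  | zero => rfl
  | succ n ih =>
    rw [Function.iterate_succ_apply]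
    refine (ih (abs_stepMean_le hC)).trans ?_
    rw [← integral_fst_of_invariant hinv fun x => h x ^ 2]
    exact integral_sq_integral_kernel_le (by fun_prop) (memLp_two_fst_of_invariant hinv hC)

theorem integral_sq_stepMean_iterate_le_of_gap (hinv : (ν.bind κ).map Prod.fst = ν)
    {Qop : Lp ℝ 2 ν →L[ℝ] Lp ℝ 2 ν}
    (hQop : ∀ f : Lp ℝ 2 ν,
      (Qop f : Lp ℝ 2 ν) =ᵐ[ν] fun x => ∑' y, (κ x {p | p.1 = y}).toReal * f y)
    {m : ℕ} {R : constOrthoCompl S ν →L[ℝ] constOrthoCompl S ν}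
    (hR : ∀ v : constOrthoCompl S ν,
      (R v : Lp ℝ 2 ν) =
        ((ContinuousLinearMap.adjoint Qop) ^ m * Qop ^ m) (v : Lp ℝ 2 ν))
    {g : ℝ} (hg : g = absGapWithRes ((ContinuousLinearMap.adjoint Qop) ^ m * Qop ^ m) R)
    (hg0 : 0 < g) {h : S → ℝ} {C : ℝ} (hC : ∀ x, |h x| ≤ C) (h0 : ∫ x, h x ∂ν = 0) :
    ∫ x, (stepMean κ)^[m] h x ^ 2 ∂ν ≤ (1 - g) * ∫ x, h x ^ 2 ∂ν := by
  have hadj : (ContinuousLinearMap.adjoint Qop) ^ m = ContinuousLinearMap.adjoint (Qop ^ m) := by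
    simp only [← ContinuousLinearMap.star_eq_adjoint, star_pow]
  rw [hadj] at hg hR
  have hh : MemLp h 2 ν := memLp_two_of_bounded hC
  have : CompleteSpace (constOrthoCompl S ν) := by
    unfold constOrthoCompl
    infer_instance
  have key := norm_sq_le_of_absGapWithRes_pos (Qop ^ m) (constOrthoCompl S ν) R hR
    (hg ▸ hg0) ⟨hh.toLp h, mem_constOrthoCompl_of_integral_eq_zero hh h0⟩
  rwa [← hg, norm_sq_eq_integral_of_ae_eq hh.coeFn_toLp, norm_sq_eq_integral_of_ae_eq
    (operator_pow_ae_eq_stepMean_iterate hinv hQop hC m _ hh.coeFn_toLp)] at key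

theorem integral_sq_stepMean_iterate_le_pow (hinv : (ν.bind κ).map Prod.fst = ν)
    {m : ℕ} {c : ℝ} (hc0 : 0 ≤ c)
    (hgap : ∀ (h : S → ℝ) (C : ℝ), (∀ x, |h x| ≤ C) → ∫ x, h x ∂ν = 0 →
      ∫ x, (stepMean κ)^[m] h x ^ 2 ∂ν ≤ c * ∫ x, h x ^ 2 ∂ν)
    {h : S → ℝ} {C : ℝ} (hC : ∀ x, |h x| ≤ C) (h0 : ∫ x, h x ∂ν = 0) (n : ℕ) :
    ∫ x, (stepMean κ)^[n] h x ^ 2 ∂ν ≤ c ^ (n / m) * ∫ x, h x ^ 2 ∂ν := by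
  have key : ∀ e, ∫ x, (stepMean κ)^[m * e] h x ^ 2 ∂ν ≤ c ^ e * ∫ x, h x ^ 2 ∂ν := by
    intro e
    induction e with
    | zero => simp
    | succ e ih =>
      rw [mul_add, mul_one, add_comm, Function.iterate_add_apply, pow_succ', mul_assoc]
      refine (hgap _ C (abs_stepMean_iterate_le hC _) ?_).trans
        (mul_le_mul_of_nonneg_left ih hc0)
      rw [integral_stepMean_iterate hinv hC, h0]
  refine le_trans ?_ (key (n / m))
  conv_lhs => rw [← Nat.mod_add_div n m, Function.iterate_add_apply]
  exact integral_sq_stepMean_iterate_le hinv (abs_stepMean_iterate_le hC _) _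

end Kernel

section MarkovAdditiveChain

variable {S E Ω : Type*} [MeasurableSpace S] [MeasurableSpace E]

/-- The σ-algebra generated by the first `n` pairs `(Y i, Z i)`. -/
abbrev pairHistory (Y : ℕ → Ω → S) (Z : ℕ → Ω → E) (n : ℕ) : MeasurableSpace Ω :=
  ⨆ i : Fin n, MeasurableSpace.comap (fun ω => (Y (i : ℕ) ω, Z (i : ℕ) ω)) inferInstance

variable {Y : ℕ → Ω → S} {Z : ℕ → Ω → E}

theorem pairHistory_mono {m n : ℕ} (h : m ≤ n) : pairHistory Y Z m ≤ pairHistory Y Z n :=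
  iSup_le fun i => le_iSup (fun i : Fin n =>
    MeasurableSpace.comap (fun ω => (Y (i : ℕ) ω, Z (i : ℕ) ω)) inferInstance) (Fin.castLE h i)

theorem measurable_pair_pairHistory {i n : ℕ} (h : i < n) :
    Measurable[pairHistory Y Z n] fun ω => (Y i ω, Z i ω) :=
  measurable_iff_comap_le.2 (le_iSup (fun i : Fin n =>
    MeasurableSpace.comap (fun ω => (Y (i : ℕ) ω, Z (i : ℕ) ω)) inferInstance) ⟨i, h⟩)

theorem measurable_fst_pairHistory {i n : ℕ} (h : i < n) :
    Measurable[pairHistory Y Z n] (Y i) :=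
  measurable_fst.comp (measurable_pair_pairHistory h)

variable [MeasurableSpace Ω]

theorem pairHistory_le (hY : ∀ k, Measurable (Y k)) (hZ : ∀ k, Measurable (Z k)) (n : ℕ) :
    pairHistory Y Z n ≤ ‹MeasurableSpace Ω› :=
  iSup_le fun i => ((hY i).prodMk (hZ i)).comap_le

/-- Property (M1): given the history, `(Y (n + 1), Z (n + 1))` has law `κ (Y n)`. -/
def HasPropertyM1 (μ : Measure Ω) (Y : ℕ → Ω → S) (Z : ℕ → Ω → E) (κ : Kernel S (S × E)) :
    Prop :=
  ∀ n, ∀ A : Set (S × E), MeasurableSet A → ∀ B : Set Ω,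
    MeasurableSet[pairHistory Y Z (n + 1)] B →
      μ (B ∩ {ω | (Y (n + 1) ω, Z (n + 1) ω) ∈ A}) = ∫⁻ ω in B, κ (Y n ω) A ∂μ

variable {μ : Measure Ω} {κ : Kernel S (S × E)}

namespace HasPropertyM1

theorem map_restrict (hM : HasPropertyM1 μ Y Z κ) (hY : ∀ k, Measurable (Y k))
    (hZ : ∀ k, Measurable (Z k)) (n : ℕ) {B : Set Ω}
    (hB : MeasurableSet[pairHistory Y Z (n + 1)] B) :
    (μ.restrict B).map (fun ω => (Y (n + 1) ω, Z (n + 1) ω))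
      = ((μ.restrict B).map (Y n)).bind κ := by
  ext A hA
  have hW := (hY (n + 1)).prodMk (hZ (n + 1))
  rw [Measure.map_apply hW hA, Measure.restrict_apply (hW hA), Set.inter_comm,
    Measure.bind_apply hA κ.aemeasurable, lintegral_map (κ.measurable_coe hA) (hY n)]
  exact hM n A hA B hB

theorem map_pair (hM : HasPropertyM1 μ Y Z κ) (hY : ∀ k, Measurable (Y k))
    (hZ : ∀ k, Measurable (Z k)) (n : ℕ) :
    μ.map (fun ω => (Y (n + 1) ω, Z (n + 1) ω)) = (μ.map (Y n)).bind κ := by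
  simpa using hM.map_restrict hY hZ n MeasurableSet.univ

theorem map_fst_eq (hM : HasPropertyM1 μ Y Z κ) (hY : ∀ k, Measurable (Y k))
    (hZ : ∀ k, Measurable (Z k)) {ν : Measure S} (hinv : (ν.bind κ).map Prod.fst = ν)
    (h0 : μ.map (Y 0) = ν) (n : ℕ) : μ.map (Y n) = ν := by
  induction n with
  | zero => exact h0
  | succ n ih =>
    have h := hM.map_pair hY hZ n
    rw [ih] at h
    rw [← hinv, ← h, Measure.map_map measurable_fst ((hY (n + 1)).prodMk (hZ (n + 1)))]
    rfl

variable [IsProbabilityMeasure μ] [IsMarkovKernel κ]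

theorem condExp_eq (hM : HasPropertyM1 μ Y Z κ) (hY : ∀ k, Measurable (Y k))
    (hZ : ∀ k, Measurable (Z k)) (n : ℕ) {g : S × E → ℝ} (hg : Measurable g)
    (hgi : Integrable (fun ω => g (Y (n + 1) ω, Z (n + 1) ω)) μ) :
    (fun ω => ∫ p, g p ∂κ (Y n ω)) =ᵐ[μ]
      μ[fun ω => g (Y (n + 1) ω, Z (n + 1) ω) | pairHistory Y Z (n + 1)] := by
  have hW := (hY (n + 1)).prodMk (hZ (n + 1))
  have hG : Measurable fun x => ∫ p, g p ∂κ x := measurable_integral_kernel hg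
  have hi : ∀ B, MeasurableSet[pairHistory Y Z (n + 1)] B →
      Integrable g (((μ.restrict B).map (Y n)).bind κ) := by
    intro B hB
    rw [← hM.map_restrict hY hZ n hB,
      integrable_map_measure hg.aestronglyMeasurable hW.aemeasurable]
    exact hgi.restrict
  refine ae_eq_condExp_of_forall_setIntegral_eq (pairHistory_le hY hZ _) hgi ?_ ?_ ?_
  · intro B hB _
    exact (integrable_map_measure hG.aestronglyMeasurable (hY n).aemeasurable).1
      (integrable_integral_kernel (hi B hB))
  · intro B hB _
    rw [← integral_map (hY n).aemeasurable hG.aestronglyMeasurable,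
      ← integral_measure_comp (hi B hB), ← hM.map_restrict hY hZ n hB,
      integral_map hW.aemeasurable hg.aestronglyMeasurable]
  · exact (hG.comp (measurable_fst_pairHistory n.lt_succ_self)).stronglyMeasurable
      |>.aestronglyMeasurable

theorem integral_mul_eq (hM : HasPropertyM1 μ Y Z κ) (hY : ∀ k, Measurable (Y k))
    (hZ : ∀ k, Measurable (Z k)) (n : ℕ) {X : Ω → ℝ}
    (hXm : Measurable[pairHistory Y Z (n + 1)] X) (hX : MemLp X 2 μ)
    {g : S × E → ℝ} (hg : Measurable g)
    (hg2 : MemLp (fun ω => g (Y (n + 1) ω, Z (n + 1) ω)) 2 μ) :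
    ∫ ω, X ω * g (Y (n + 1) ω, Z (n + 1) ω) ∂μ = ∫ ω, X ω * ∫ p, g p ∂κ (Y n ω) ∂μ := by
  have hgi := hg2.integrable one_le_two
  have h1 := condExp_mul_of_stronglyMeasurable_left (μ := μ) hXm.stronglyMeasurable
    (hX.integrable_mul hg2) hgi
  have h2 := integral_condExp (pairHistory_le hY hZ (n + 1)) (μ := μ)
    (f := X * fun ω => g (Y (n + 1) ω, Z (n + 1) ω))
  refine h2.symm.trans (integral_congr_ae ?_)
  filter_upwards [h1, hM.condExp_eq hY hZ n hg hgi] with ω hω hω'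
  rw [hω, Pi.mul_apply, ← hω']

variable [Countable S] [MeasurableSingletonClass S]

theorem integral_mul_eq_iterate (hM : HasPropertyM1 μ Y Z κ) (hY : ∀ k, Measurable (Y k))
    (hZ : ∀ k, Measurable (Z k)) (i n : ℕ) {X : Ω → ℝ}
    (hXm : Measurable[pairHistory Y Z (i + 1)] X) (hX : MemLp X 2 μ)
    {h : S → ℝ} {C : ℝ} (hC : ∀ x, |h x| ≤ C) :
    ∫ ω, X ω * h (Y (i + n) ω) ∂μ = ∫ ω, X ω * (stepMean κ)^[n] h (Y i ω) ∂μ := by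
  induction n generalizing h with
  | zero => rfl
  | succ n ih =>
    rw [Function.iterate_succ_apply, ← ih (abs_stepMean_le hC)]
    have hm : Measurable fun p : S × E => h p.1 := Measurable.of_discrete.comp measurable_fst
    exact hM.integral_mul_eq hY hZ (i + n)
      (hXm.mono (pairHistory_mono (by omega)) le_rfl) hX hm
      (MemLp.of_bound (hm.comp ((hY _).prodMk (hZ _))).aestronglyMeasurable C
        (ae_of_all _ fun _ => hC _))

/-- Decay of correlations between `f (Y i, Z i)` and `g (Y j, Z j)` for `i < j`. -/
theorem sq_integral_mul_le_pow (hM : HasPropertyM1 μ Y Z κ) (hY : ∀ k, Measurable (Y k))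
    (hZ : ∀ k, Measurable (Z k)) {ν : Measure S} [IsProbabilityMeasure ν]
    (hinv : (ν.bind κ).map Prod.fst = ν) (h0 : μ.map (Y 0) = ν)
    {m : ℕ} {c : ℝ} (hc0 : 0 ≤ c)
    (hgap : ∀ (h : S → ℝ) (C : ℝ), (∀ x, |h x| ≤ C) → ∫ x, h x ∂ν = 0 →
      ∫ x, (stepMean κ)^[m] h x ^ 2 ∂ν ≤ c * ∫ x, h x ^ 2 ∂ν)
    {f g : S × E → ℝ} (hf : Measurable f) (hg : Measurable g)
    (hf2 : MemLp f 2 (ν.bind κ)) (hg2 : MemLp g 2 (ν.bind κ)) (hg0 : ∫ p, g p ∂(ν.bind κ) = 0)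
    {C : ℝ} (hC : ∀ x, |∫ p, g p ∂κ x| ≤ C) (i n : ℕ) :
    (∫ ω, f (Y (i + 1) ω, Z (i + 1) ω) * g (Y (i + 1 + n + 1) ω, Z (i + 1 + n + 1) ω) ∂μ) ^ 2
      ≤ c ^ (n / m) * ((∫ p, f p ^ 2 ∂(ν.bind κ)) * ∫ p, g p ^ 2 ∂(ν.bind κ)) := by
  have hYlaw := hM.map_fst_eq hY hZ hinv h0
  have hWm : ∀ k, Measurable fun ω => (Y k ω, Z k ω) := fun k => (hY k).prodMk (hZ k)
  have hWlaw : ∀ k, μ.map (fun ω => (Y (k + 1) ω, Z (k + 1) ω)) = ν.bind κ := fun k => by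
    rw [hM.map_pair hY hZ, hYlaw]
  have hmem : ∀ {u : S × E → ℝ} (_ : MemLp u 2 (ν.bind κ)) (k : ℕ),
      MemLp (fun ω => u (Y (k + 1) ω, Z (k + 1) ω)) 2 μ := fun {u} hu k => by
    rw [← hWlaw k] at hu
    exact hu.comp_of_map (hWm _).aemeasurable
  set G : S → ℝ := fun x => ∫ p, g p ∂κ x
  have hXm : Measurable[pairHistory Y Z (i + 1 + 1)] fun ω => f (Y (i + 1) ω, Z (i + 1) ω) :=
    hf.comp (measurable_pair_pairHistory (Nat.lt_succ_self _))
  have hX := hmem hf2 i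
  have hP : MemLp (fun ω => (stepMean κ)^[n] G (Y (i + 1) ω)) 2 μ :=
    MemLp.of_bound (Measurable.of_discrete.comp (hY _)).aestronglyMeasurable C
      (ae_of_all _ fun _ => abs_stepMean_iterate_le hC n _)
  rw [hM.integral_mul_eq hY hZ (i + 1 + n) (hXm.mono (pairHistory_mono (by omega)) le_rfl) hX
    hg (hmem hg2 _), hM.integral_mul_eq_iterate hY hZ (i + 1) n hXm hX hC]
  have e1 : ∫ ω, f (Y (i + 1) ω, Z (i + 1) ω) ^ 2 ∂μ = ∫ p, f p ^ 2 ∂(ν.bind κ) := by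
    rw [← hWlaw i, integral_map (hWm _).aemeasurable (hf.pow_const 2).aestronglyMeasurable]
  have e2 : ∫ ω, (stepMean κ)^[n] G (Y (i + 1) ω) ^ 2 ∂μ
      = ∫ x, (stepMean κ)^[n] G x ^ 2 ∂ν := by
    rw [← hYlaw (i + 1), integral_map (hY _).aemeasurable
      Measurable.of_discrete.aestronglyMeasurable]
  have hG0 : ∫ x, G x ∂ν = 0 := by
    rw [← hg0, integral_measure_comp (hg2.integrable one_le_two)]
  calc _ ≤ _ := sq_integral_mul_le hX hP
    _ = (∫ p, f p ^ 2 ∂(ν.bind κ)) * ∫ x, (stepMean κ)^[n] G x ^ 2 ∂ν := by rw [e1, e2]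
    _ ≤ (∫ p, f p ^ 2 ∂(ν.bind κ)) * (c ^ (n / m) * ∫ p, g p ^ 2 ∂(ν.bind κ)) := by
        refine mul_le_mul_of_nonneg_left ?_ (integral_nonneg fun _ => sq_nonneg _)
        refine (integral_sq_stepMean_iterate_le_pow hinv hc0 hgap hC hG0 n).trans ?_
        exact mul_le_mul_of_nonneg_left (integral_sq_integral_kernel_le hg hg2)
          (pow_nonneg hc0 _)
    _ = _ := by ring

/-- Variance of an additive functional in terms of an `L²` contraction rate of the `m`-step
transition operator on mean-zero functions. -/
theorem variance_sum_le (hM : HasPropertyM1 μ Y Z κ) (hY : ∀ k, Measurable (Y k))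
    (hZ : ∀ k, Measurable (Z k)) {ν : Measure S} [IsProbabilityMeasure ν]
    (hinv : (ν.bind κ).map Prod.fst = ν) (h0 : μ.map (Y 0) = ν)
    {m : ℕ} {q : ℝ} (hq0 : 0 ≤ q)
    (hgap : ∀ (h : S → ℝ) (C : ℝ), (∀ x, |h x| ≤ C) → ∫ x, h x ∂ν = 0 →
      ∫ x, (stepMean κ)^[m] h x ^ 2 ∂ν ≤ q ^ 2 * ∫ x, h x ^ 2 ∂ν)
    {f : ℕ → S × E → ℝ} (hf : ∀ i, Measurable (f i)) (hf2 : ∀ i, MemLp (f i) 2 (ν.bind κ))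
    (hfκ : ∀ i x, Integrable (f i) (κ x)) (hC : ∀ i, ∃ C, ∀ x, |∫ p, f i p ∂κ x| ≤ C) (k : ℕ) :
    Var[fun ω => ∑ i ∈ Finset.Icc 1 k, f i (Y i ω, Z i ω); μ]
      ≤ (1 + 2 * ∑ d ∈ Finset.range k, q ^ (d / m))
        * ∑ i ∈ Finset.Icc 1 k, Var[fun ω => f i (Y 1 ω, Z 1 ω); μ] := by
  have hYlaw := hM.map_fst_eq hY hZ hinv h0
  have hWm : ∀ k, Measurable fun ω => (Y k ω, Z k ω) := fun k => (hY k).prodMk (hZ k)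
  have hfm : ∀ i j, Measurable fun ω => f i (Y j ω, Z j ω) := fun i j => (hf i).comp (hWm j)
  have hWlaw : ∀ k, 1 ≤ k → μ.map (fun ω => (Y k ω, Z k ω)) = ν.bind κ := by
    intro k hk
    obtain ⟨k, rfl⟩ := Nat.exists_eq_add_of_le' hk
    rw [hM.map_pair hY hZ, hYlaw]
  have hint : ∀ {u : S × E → ℝ} (_ : Measurable u) (k : ℕ), 1 ≤ k →
      ∫ ω, u (Y k ω, Z k ω) ∂μ = ∫ p, u p ∂(ν.bind κ) := fun {u} hu k hk => by
    rw [← hWlaw k hk, integral_map (hWm _).aemeasurable hu.aestronglyMeasurable]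
  have hmem : ∀ i j, 1 ≤ j → MemLp (fun ω => f i (Y j ω, Z j ω)) 2 μ := fun i j hj => by
    have h := hf2 i
    rw [← hWlaw j hj] at h
    exact h.comp_of_map (hWm _).aemeasurable
  set e : ℕ → ℝ := fun i => ∫ p, f i p ∂(ν.bind κ) with he
  set g : ℕ → S × E → ℝ := fun i p => f i p - e i with hgdef
  set a : ℕ → ℝ := fun i => ∫ p, g i p ^ 2 ∂(ν.bind κ)
  have hg : ∀ i, Measurable (g i) := fun i => (hf i).sub_const _
  have hg2 : ∀ i, MemLp (g i) 2 (ν.bind κ) := fun i => (hf2 i).sub (memLp_const _)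
  have hg0 : ∀ i, ∫ p, g i p ∂(ν.bind κ) = 0 := fun i => by
    simp only [hgdef]
    rw [integral_sub ((hf2 i).integrable one_le_two) (integrable_const _)]
    simp [he]
  have hgC : ∀ i, ∃ C, ∀ x, |∫ p, g i p ∂κ x| ≤ C := fun i => by
    obtain ⟨C, hC⟩ := hC i
    refine ⟨C + |e i|, fun x => ?_⟩
    simp only [hgdef]
    rw [integral_sub (hfκ i x) (integrable_const _)]
    simpa using (abs_sub _ _).trans (add_le_add_left (hC x) _)
  have ha : ∀ i, 0 ≤ a i := fun i => integral_nonneg fun _ => sq_nonneg _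
  have hvar : ∀ i j, 1 ≤ j → Var[fun ω => f i (Y j ω, Z j ω); μ] = a i := fun i j hj => by
    rw [variance_eq_integral (hfm i j).aemeasurable, hint (hf i) j hj]
    exact hint ((hg i).pow_const 2) j hj
  have hcov : ∀ i j, 1 ≤ i → 1 ≤ j → cov[fun ω => f i (Y i ω, Z i ω),
      fun ω => f j (Y j ω, Z j ω); μ] = ∫ ω, g i (Y i ω, Z i ω) * g j (Y j ω, Z j ω) ∂μ := by
    intro i j hi hj
    rw [covariance, hint (hf i) i hi, hint (hf j) j hj]
  have hdecay : ∀ i j, 1 ≤ i → i < j → cov[fun ω => f i (Y i ω, Z i ω),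
      fun ω => f j (Y j ω, Z j ω); μ] ≤ q ^ ((j - i - 1) / m) * ((a i + a j) / 2) := by
    intro i j hi hij
    rw [hcov i j hi (by omega)]
    obtain ⟨n, rfl⟩ := Nat.exists_eq_add_of_lt hij
    obtain ⟨i, rfl⟩ := Nat.exists_eq_add_of_le' hi
    obtain ⟨C, hC⟩ := hgC (i + 1 + n + 1)
    have hsq := hM.sq_integral_mul_le_pow hY hZ hinv h0 (sq_nonneg q) hgap (hg (i + 1)) (hg _)
      (hg2 (i + 1)) (hg2 _) (hg0 _) hC i n
    rw [show i + 1 + n + 1 - (i + 1) - 1 = n by omega]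
    have hnn : 0 ≤ q ^ (n / m) * ((a (i + 1) + a (i + 1 + n + 1)) / 2) :=
      mul_nonneg (pow_nonneg hq0 _) (by linarith [ha (i + 1), ha (i + 1 + n + 1)])
    refine (le_abs_self _).trans (abs_le_of_sq_le_sq ?_ hnn)
    refine hsq.trans ?_
    rw [mul_pow, ← pow_mul, ← pow_mul, mul_comm 2]
    refine mul_le_mul_of_nonneg_left ?_ (by positivity)
    change a (i + 1) * a (i + 1 + n + 1) ≤ _
    nlinarith [sq_nonneg (a (i + 1) - a (i + 1 + n + 1))]
  rw [variance_fun_sum' fun i hi => hmem i i (Finset.mem_Icc.1 hi).1,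
    Finset.sum_congr rfl fun i _ => hvar i 1 le_rfl]
  refine sum_sum_le_of_decay (fun d => pow_nonneg hq0 (d / m)) ha ?_
  intro i hi j hj
  have hi1 := (Finset.mem_Icc.1 hi).1
  have hj1 := (Finset.mem_Icc.1 hj).1
  rcases lt_trichotomy i j with h | h | h
  · rw [if_neg h.ne, Nat.dist_eq_sub_of_le h.le]
    exact hdecay i j hi1 h
  · subst h
    rw [covariance_self (hfm i i).aemeasurable, hvar i i hi1, if_pos rfl]
    linarith
  · rw [if_neg h.ne', Nat.dist_eq_sub_of_le_right h.le, covariance_comm, add_comm (a i)]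
    exact hdecay j i hj1 h

end HasPropertyM1

end MarkovAdditiveChain

section Assembly

theorem map_fst_bind_eq_of_isStationaryDist {S E : Type*} [Countable S] [MeasurableSpace S]
    [MeasurableSingletonClass S] [MeasurableSpace E] {κ : Kernel S (S × E)} {π : S → ℝ≥0∞}
    (hπ : IsStationaryDist (fun x y => κ x {p | p.1 = y}) π) {ν : Measure S}
    (hν : ∀ x, ν {x} = π x) : (ν.bind κ).map Prod.fst = ν := by
  refine Measure.ext_of_singleton fun y => ?_
  have hy : MeasurableSet (Prod.fst ⁻¹' {y} : Set (S × E)) :=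
    measurable_fst (measurableSet_singleton y)
  rw [Measure.map_apply measurable_fst (measurableSet_singleton y),
    Measure.bind_apply hy κ.aemeasurable, lintegral_countable', hν, ← hπ.2 y]
  refine tsum_congr fun x => ?_
  rw [hν, mul_comm]
  rfl

theorem gap_div_mul_le {g q : ℝ} {m : ℕ} (hm : 0 < m) (hg1 : g ≤ 1) (hq0 : 0 ≤ q)
    (hq : q ^ 2 = 1 - g) (k : ℕ) :
    g / m * (1 + 2 * ∑ d ∈ Finset.range k, q ^ (d / m)) ≤ 6 := by
  have hm' : (1 : ℝ) ≤ m := by exact_mod_cast hm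
  have h1 := one_sub_mul_sum_pow_div_le hq0 hm k
  set T := ∑ d ∈ Finset.range k, q ^ (d / m)
  have hT : 0 ≤ T := Finset.sum_nonneg fun _ _ => pow_nonneg hq0 _
  have h2 : g / 2 ≤ 1 - q := by nlinarith [sq_nonneg (1 - q)]
  have h3 : g / 2 * T ≤ m := (mul_le_mul_of_nonneg_right h2 hT).trans h1
  rw [div_mul_eq_mul_div, div_le_iff₀ (by linarith)]
  nlinarith

theorem le_six_div_iSup_gap_mul {G : ℕ → ℝ} {c V A : ℝ} {k : ℕ} (hG : ∀ m, G m ≤ 1)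
    (hc0 : 0 < c) (hc : c = ⨆ m : ℕ, if m = 0 then (0 : ℝ) else G m / (m : ℝ))
    (hV : 0 ≤ V) (hA : 0 ≤ A)
    (h : ∀ m, 0 < G m → V ≤ (1 + 2 * ∑ d ∈ Finset.range k, √(1 - G m) ^ (d / m)) * A) :
    V ≤ 6 / c * A := by
  rcases hV.eq_or_lt with rfl | hV0
  · positivity
  have hsup : c ≤ 6 * A / V := by
    rw [hc]
    refine ciSup_le fun m => ?_
    split_ifs with hm
    · positivity
    rcases le_or_gt (G m) 0 with hg | hg
    · exact (div_nonpos_of_nonpos_of_nonneg hg (Nat.cast_nonneg m)).trans (by positivity)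
    rw [le_div_iff₀ hV0]
    calc G m / m * V
        ≤ G m / m * ((1 + 2 * ∑ d ∈ Finset.range k, √(1 - G m) ^ (d / m)) * A) :=
          mul_le_mul_of_nonneg_left (h m hg) (by positivity)
      _ = G m / m * (1 + 2 * ∑ d ∈ Finset.range k, √(1 - G m) ^ (d / m)) * A := by ring
      _ ≤ 6 * A := mul_le_mul_of_nonneg_right
          (gap_div_mul_le (Nat.pos_of_ne_zero hm) (hG m) (Real.sqrt_nonneg _)
            (Real.sq_sqrt (by linarith [hG m])) k) hA
  rw [le_div_iff₀ hV0] at hsup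
  rw [div_mul_eq_mul_div, le_div_iff₀ hc0]
  linarith

end Assembly

end MarkovAdditive

/-- Proposition 5.8: variance bound for additive functionals of an (M1) process in
terms of the pseudo spectral gap of the underlying chain. -/
theorem variance_bound_pseudo_spectral_gap
    {S : Type} [Countable S] [MeasurableSpace S] [MeasurableSingletonClass S]
    {E : Type} [TopologicalSpace E] [PolishSpace E] [MeasurableSpace E] [BorelSpace E]
    {Ω : Type} [MeasurableSpace Ω] (μ : Measure Ω) [IsProbabilityMeasure μ]
    (Y : ℕ → Ω → S) (Z : ℕ → Ω → E)
    (hY : ∀ k, Measurable (Y k)) (hZ : ∀ k, Measurable (Z k))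
    (κ : ProbabilityTheory.Kernel S (S × E)) [ProbabilityTheory.IsMarkovKernel κ]
    -- property (M1): conditionally on the history, `(Y_k, Z_k)` has law `κ (Y_{k-1})`
    (hM1 : ∀ k : ℕ, 1 ≤ k → ∀ A : Set (S × E), MeasurableSet A →
      ∀ B : Set Ω,
        MeasurableSet[⨆ i : Fin k,
          MeasurableSpace.comap (fun ω => (Y (i : ℕ) ω, Z (i : ℕ) ω)) inferInstance] B →
        μ (B ∩ {ω | (Y k ω, Z k ω) ∈ A}) = ∫⁻ ω in B, κ (Y (k - 1) ω) A ∂μ)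
    (hirr : ChainIrreducible fun x y => κ x {p | p.1 = y})
    (π : S → ℝ≥0∞) (hπ : IsStationaryDist (fun x y => κ x {p | p.1 = y}) π)
    -- the chain is started from its stationary distribution (`P_μ`)
    (hinit : ∀ x, μ {ω | Y 0 ω = x} = π x)
    -- the measure on `S` defined by `π`, and the Markov operator `Q` on `ℓ²(π)`
    (ν : Measure S) [IsProbabilityMeasure ν] (hν : ∀ x, ν {x} = π x)
    (Qop : Lp ℝ 2 ν →L[ℝ] Lp ℝ 2 ν)
    (hQop : ∀ f : Lp ℝ 2 ν,
      (Qop f : Lp ℝ 2 ν) =ᵐ[ν] fun x => ∑' y, (κ x {p | p.1 = y}).toReal * f y)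
    -- the restriction of `(Q*)^k Q^k` to the orthogonal complement of constants
    (Kres : ∀ _ : ℕ, (constOrthoCompl S ν →L[ℝ] constOrthoCompl S ν))
    (hKres : ∀ (k : ℕ) (v : constOrthoCompl S ν),
      ((Kres k v : Lp ℝ 2 ν)) =
        (((ContinuousLinearMap.adjoint Qop) ^ k * Qop ^ k) (v : Lp ℝ 2 ν)))
    -- the pseudo spectral gap
    (γps : ℝ) (hγpos : 0 < γps)
    (hγdef : γps = ⨆ k : ℕ, if k = 0 then (0 : ℝ) else
      absGapWithRes ((ContinuousLinearMap.adjoint Qop) ^ k * Qop ^ k) (Kres k) / (k : ℝ))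
    (f : ℕ → S × E → ℝ) (hf : ∀ i, Measurable (f i))
    -- `sup_u E_u[f_i(Y_1, Z_1)²] < ∞`
    (hsq : ∀ i, (⨆ u : S, ∫⁻ p, ENNReal.ofReal ((f i p) ^ 2) ∂(κ u)) ≠ ⊤)
    (k : ℕ) (hk : 1 ≤ k) :
    ProbabilityTheory.variance (fun ω => ∑ i ∈ Finset.Icc 1 k, f i (Y i ω, Z i ω)) μ ≤
      (6 / γps) * ∑ i ∈ Finset.Icc 1 k,
        ProbabilityTheory.variance (fun ω => f i (Y 1 ω, Z 1 ω)) μ := by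
  have hM : HasPropertyM1 μ Y Z κ := fun n A hA B hB => hM1 (n + 1) (by omega) A hA B hB
  have hinv := map_fst_bind_eq_of_isStationaryDist hπ hν
  have h0 : μ.map (Y 0) = ν := Measure.ext_of_singleton fun x => by
    rw [Measure.map_apply (hY 0) (measurableSet_singleton x), hν, ← hinit]
    rfl
  have hle : ∀ i x, ∫⁻ p, ENNReal.ofReal ((f i p) ^ 2) ∂(κ x) ≤
      ⨆ u : S, ∫⁻ p, ENNReal.ofReal ((f i p) ^ 2) ∂(κ u) := fun i x =>
    le_iSup (fun u : S => ∫⁻ p, ENNReal.ofReal ((f i p) ^ 2) ∂(κ u)) x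
  have hfκ : ∀ i x, MemLp (f i) 2 (κ x) := fun i x =>
    memLp_two_of_lintegral_ne_top (hf i) (ne_top_of_le_ne_top (hsq i) (hle i x))
  have hfν : ∀ i, MemLp (f i) 2 (ν.bind κ) := fun i => by
    refine memLp_two_of_lintegral_ne_top (hf i) (ne_top_of_le_ne_top (hsq i) ?_)
    rw [Measure.lintegral_bind κ.aemeasurable
      ((hf i).pow_const 2).ennreal_ofReal.aemeasurable]
    refine (lintegral_mono (hle i)).trans ?_
    rw [lintegral_const, measure_univ, mul_one]
  have hC : ∀ i, ∃ C, ∀ x, |∫ p, f i p ∂κ x| ≤ C := fun i => by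
    refine ⟨√(⨆ u : S, ∫⁻ p, ENNReal.ofReal ((f i p) ^ 2) ∂(κ u)).toReal,
      fun x => Real.abs_le_sqrt ?_⟩
    refine (sq_integral_le_integral_sq (hfκ i x)).trans ?_
    rw [integral_eq_lintegral_of_nonneg_ae (ae_of_all _ fun _ => sq_nonneg _)
      ((hf i).pow_const 2).aestronglyMeasurable]
    exact ENNReal.toReal_mono (hsq i) (hle i x)
  refine le_six_div_iSup_gap_mul (k := k) (fun m => absGapWithRes_le_one _ (Kres m)) hγpos hγdef
    (ProbabilityTheory.variance_nonneg _ _)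
    (Finset.sum_nonneg fun _ _ => ProbabilityTheory.variance_nonneg _ _) fun m hg => ?_
  refine hM.variance_sum_le hY hZ hinv h0 (m := m) (Real.sqrt_nonneg _) (fun h C hC h0 => ?_)
    hf hfν (fun i x => (hfκ i x).integrable one_le_two) hC k
  rw [Real.sq_sqrt (sub_nonneg.2 (absGapWithRes_le_one _ (Kres m)))]
  exact integral_sq_stepMean_iterate_le_of_gap hinv hQop (hKres m) rfl hg hC h0
end
end

section
/- Stein's method of exchangeable pairs for exponential moments: Let 𝒳 be a separable metric space and let (X,X') be an exchangeable pair of 𝒳-valued random variables, i.e. (X,X') and (X',X) have the same joint law. Let f : 𝒳 → ℝ with E[f(X)] = 0, and suppose F : 𝒳×𝒳 → ℝ is a square-integrable antisymmetric function (F(x,y) = −F(y,x)) satisfying f(X) = E[F(X,X') | X] almost surely and E|e^{θ f(X)} F(X,X')| < ∞ for all θ ∈ ℝ. Define Δ(X) := (1/2)·E[ |F(X,X')·(f(X) − f(X'))| | X ]. Then for all θ ∈ ℝ: |E[ f(X)·e^{θ f(X)} ]| ≤ |θ| · E[ e^{θ f(X)} · Δ(X) ]. -/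
open MeasureTheory

/-- The exponential satisfies the trapezoidal bound for its increments. -/
theorem abs_exp_sub_exp_le_mul_average (x y : ℝ) :
    |Real.exp x - Real.exp y| ≤ |x - y| * ((Real.exp x + Real.exp y) / 2) := by
  have key : ∀ u : ℝ, 0 ≤ u → Real.exp u - 1 ≤ u * ((Real.exp u + 1) / 2) := by
    have hd : ∀ u : ℝ, HasDerivAt
        (fun u : ℝ => u * ((Real.exp u + 1) / 2) - (Real.exp u - 1))
        (1 * ((Real.exp u + 1) / 2) + u * (Real.exp u / 2) - Real.exp u) u := fun u =>
      ((hasDerivAt_id' u).mul (((Real.hasDerivAt_exp u).add_const 1).div_const 2)).sub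
        ((Real.hasDerivAt_exp u).sub_const 1)
    have hm := monotoneOn_of_deriv_nonneg (convex_Ici (0 : ℝ))
      (f := fun u : ℝ => u * ((Real.exp u + 1) / 2) - (Real.exp u - 1))
      (fun u _ => (hd u).continuousAt.continuousWithinAt)
      (fun u _ => (hd u).differentiableAt.differentiableWithinAt)
      (fun u _ => by
        rw [(hd u).deriv]
        have h₁ := Real.add_one_le_exp (-u)
        have h₂ : Real.exp (-u) * Real.exp u = 1 := by rw [← Real.exp_add]; simp
        nlinarith [Real.exp_pos u])
    intro u hu
    have := hm Set.self_mem_Ici hu hu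
    simp only [Real.exp_zero] at this
    linarith
  wlog h : y ≤ x generalizing x y
  · rw [abs_sub_comm, abs_sub_comm x, add_comm]
    exact this y x (le_of_not_ge h)
  rw [abs_of_nonneg (sub_nonneg.2 (Real.exp_le_exp.2 h)), abs_of_nonneg (sub_nonneg.2 h)]
  have hk := key (x - y) (sub_nonneg.2 h)
  have he : Real.exp x = Real.exp (x - y) * Real.exp y := by rw [← Real.exp_add]; ring_nf
  rw [he]
  nlinarith [Real.exp_pos y]

/-- A factor `|a - b|` in front of `exp (θ * a)` is absorbed by exponentials of multiples of
`a` and `b` separately. -/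
theorem exp_mul_abs_sub_le (θ a b : ℝ) :
    Real.exp (θ * a) * |a - b| ≤ Real.exp ((θ + 1) * a) + Real.exp ((θ - 1) * a)
      + (2 * Real.exp ((2 * θ) * a) + Real.exp (2 * b) + Real.exp ((-2) * b)) := by
  have habs : ∀ t : ℝ, |t| ≤ Real.exp t + Real.exp (-t) := fun t => by
    rcases abs_cases t with h | h <;>
      linarith [Real.add_one_le_exp t, Real.add_one_le_exp (-t), Real.exp_pos t,
        Real.exp_pos (-t)]
  have hsq : ∀ t : ℝ, Real.exp (2 * t) = Real.exp t ^ 2 := fun t => by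
    rw [← Real.exp_nat_mul]; norm_num
  have h₁ : Real.exp ((θ + 1) * a) = Real.exp (θ * a) * Real.exp a := by
    rw [← Real.exp_add]; ring_nf
  have h₂ : Real.exp ((θ - 1) * a) = Real.exp (θ * a) * Real.exp (-a) := by
    rw [← Real.exp_add]; ring_nf
  have h₃ : Real.exp ((2 * θ) * a) = Real.exp (θ * a) ^ 2 := by rw [← hsq]; ring_nf
  have h₄ : Real.exp ((-2) * b) = Real.exp (-b) ^ 2 := by rw [← hsq]; ring_nf
  rw [h₁, h₂, h₃, h₄, hsq b]
  have := mul_le_mul_of_nonneg_left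
    ((abs_sub a b).trans (add_le_add (habs a) (habs b))) (Real.exp_pos (θ * a)).le
  nlinarith [sq_nonneg (Real.exp (θ * a) - Real.exp b),
    sq_nonneg (Real.exp (θ * a) - Real.exp (-b)), sq_nonneg (Real.exp b),
    sq_nonneg (Real.exp (-b))]

/-- A factor measurable with respect to the conditioning σ-algebra passes under the integral
of a conditional expectation. -/
theorem integral_mul_condExp {Ω : Type*} {m m₀ : MeasurableSpace Ω} {μ : Measure Ω}
    (hm : m ≤ m₀) [SigmaFinite (μ.trim hm)] {h g : Ω → ℝ} (hh : StronglyMeasurable[m] h)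
    (hg : Integrable g μ) (hhg : Integrable (fun ω => h ω * g ω) μ) :
    ∫ ω, h ω * (μ[g | m]) ω ∂μ = ∫ ω, h ω * g ω ∂μ := by
  rw [← integral_condExp hm (f := fun ω => h ω * g ω)]
  exact (integral_congr_ae (condExp_mul_of_stronglyMeasurable_left hh hhg hg)).symm

/-- Stein's method of exchangeable pairs for exponential moments
(after Chatterjee). -/
theorem exchangeable_pair_exponential_moment
    {𝒳 : Type*} [MetricSpace 𝒳] [TopologicalSpace.SeparableSpace 𝒳]
    [MeasurableSpace 𝒳] [BorelSpace 𝒳]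
    {Ω : Type*} [MeasurableSpace Ω] (μ : Measure Ω) [IsProbabilityMeasure μ]
    (X X' : Ω → 𝒳) (hX : Measurable X) (hX' : Measurable X')
    (hexch : μ.map (fun ω => (X ω, X' ω)) = μ.map (fun ω => (X' ω, X ω)))
    (f : 𝒳 → ℝ) (hf : Measurable f)
    (hfmean : ∫ ω, f (X ω) ∂μ = 0)
    (F : 𝒳 → 𝒳 → ℝ) (hF : Measurable (Function.uncurry F))
    (hFanti : ∀ x y, F x y = - F y x)
    (hFsq : Integrable (fun ω => (F (X ω) (X' ω)) ^ 2) μ)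
    (hFcond : (fun ω => f (X ω)) =ᵐ[μ]
      μ[(fun ω => F (X ω) (X' ω)) | MeasurableSpace.comap X inferInstance])
    (hFint : ∀ θ : ℝ,
      Integrable (fun ω => |Real.exp (θ * f (X ω)) * F (X ω) (X' ω)|) μ)
    (θ : ℝ) :
    |∫ ω, f (X ω) * Real.exp (θ * f (X ω)) ∂μ| ≤
      |θ| * ∫ ω, Real.exp (θ * f (X ω)) *
        (μ[(fun ω' => abs (F (X ω') (X' ω') * (f (X ω') - f (X' ω'))) / 2) |
            MeasurableSpace.comap X inferInstance]) ω ∂μ := by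
  have hP : Measurable fun ω => (X ω, X' ω) := hX.prodMk hX'
  have hP' : Measurable fun ω => (X' ω, X ω) := hX'.prodMk hX
  have hswap : ProbabilityTheory.IdentDistrib
      (fun ω => (X ω, X' ω)) (fun ω => (X' ω, X ω)) μ μ :=
    ⟨hP.aemeasurable, hP'.aemeasurable, hexch⟩
  have hFX : Measurable fun ω => F (X ω) (X' ω) := hF.comp hP
  have hfX : Measurable fun ω => f (X ω) := hf.comp hX
  have hfX' : Measurable fun ω => f (X' ω) := hf.comp hX'
  have hexpm : StronglyMeasurable[MeasurableSpace.comap X inferInstance]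
      fun ω => Real.exp (θ * f (X ω)) :=
    (((hf.const_mul θ).exp).comp (comap_measurable X)).stronglyMeasurable
  have hFL2 : MemLp (fun ω => F (X ω) (X' ω)) 2 μ :=
    (memLp_two_iff_integrable_sq hFX.aestronglyMeasurable).2 hFsq
  have hFL1 : Integrable (fun ω => F (X ω) (X' ω)) μ := hFL2.integrable one_le_two
  have hfL2 : MemLp (fun ω => f (X ω)) 2 μ := (memLp_congr_ae hFcond).2 (hFL2.condExp one_le_two)
  have hfL2' : MemLp (fun ω => f (X' ω)) 2 μ :=
    (hswap.comp (hf.comp measurable_fst)).memLp_iff.1 hfL2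
  have hexpF : ∀ θ : ℝ, Integrable (fun ω => Real.exp (θ * f (X ω)) * F (X ω) (X' ω)) μ :=
    fun θ => (integrable_norm_iff
      (((hfX.const_mul θ).exp.mul hFX).aestronglyMeasurable)).1 (hFint θ)
  have hexpF' : ∀ θ : ℝ, Integrable (fun ω => Real.exp (θ * f (X' ω)) * F (X ω) (X' ω)) μ := by
    intro θ
    have h := (hswap.comp (u := fun p : 𝒳 × 𝒳 => Real.exp (θ * f p.1) * F p.1 p.2)
      (((hf.comp measurable_fst).const_mul θ).exp.mul hF)).integrable_iff.1 (hexpF θ)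
    refine h.neg.congr (.of_forall fun ω => ?_)
    simp [hFanti (X ω) (X' ω)]
  set D : Ω → ℝ := fun ω => |F (X ω) (X' ω) * (f (X ω) - f (X' ω))| / 2
  have hD : Integrable D μ := (hFL2.integrable_mul (hfL2.sub hfL2')).abs.div_const 2
  have hDm : Measurable D := (hFX.mul (hfX.sub hfX')).abs.div_const 2
  have hexpD : Integrable (fun ω => Real.exp (θ * f (X ω)) * D ω) μ := by
    refine (((hexpF (θ + 1)).abs.add (hexpF (θ - 1)).abs).add
      ((((hexpF (2 * θ)).abs.const_mul 2).add (hexpF' 2).abs).add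
        (hexpF' (-2)).abs)).mono' ((hfX.const_mul θ).exp.mul hDm).aestronglyMeasurable
      (.of_forall fun ω => ?_)
    have h := mul_le_mul_of_nonneg_left (exp_mul_abs_sub_le θ (f (X ω)) (f (X' ω)))
      (abs_nonneg (F (X ω) (X' ω)))
    have h₀ : 0 ≤ |F (X ω) (X' ω)| * (Real.exp (θ * f (X ω)) * |f (X ω) - f (X' ω)|) := by
      positivity
    simp only [D, Pi.add_apply, abs_mul, Real.abs_exp, Real.norm_eq_abs, abs_div, abs_abs,
      abs_two]
    linarith
  have hexpD_swap : ProbabilityTheory.IdentDistrib (fun ω => Real.exp (θ * f (X ω)) * D ω)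
      (fun ω => Real.exp (θ * f (X' ω)) * D ω) μ μ := by
    have h := hswap.comp
      (u := fun p : 𝒳 × 𝒳 => Real.exp (θ * f p.1) * (|F p.1 p.2 * (f p.1 - f p.2)| / 2))
      (((hf.comp measurable_fst).const_mul θ).exp.mul
        ((hF.mul ((hf.comp measurable_fst).sub (hf.comp measurable_snd))).abs.div_const 2))
    have hD_swap : ∀ ω, D ω = |F (X' ω) (X ω) * (f (X' ω) - f (X ω))| / 2 := fun ω => by
      simp only [D]
      rw [hFanti (X ω) (X' ω), abs_mul, abs_mul, abs_neg, abs_sub_comm (f (X ω))]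
    have hfun : (fun ω => Real.exp (θ * f (X' ω)) * D ω) = fun ω =>
        Real.exp (θ * f (X' ω)) * (|F (X' ω) (X ω) * (f (X' ω) - f (X ω))| / 2) :=
      funext fun ω => by rw [hD_swap]
    rw [hfun]
    exact h
  have hexpD' := hexpD_swap.integrable_iff.1 hexpD
  have hleft : ∫ ω, f (X ω) * Real.exp (θ * f (X ω)) ∂μ
      = ∫ ω, Real.exp (θ * f (X ω)) * F (X ω) (X' ω) ∂μ := by
    rw [← integral_mul_condExp hX.comap_le hexpm hFL1 (hexpF θ)]
    refine integral_congr_ae ?_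
    filter_upwards [hFcond] with ω hω
    rw [← hω, mul_comm]
  have hanti : ∫ ω, Real.exp (θ * f (X ω)) * F (X ω) (X' ω) ∂μ
      = -∫ ω, Real.exp (θ * f (X' ω)) * F (X ω) (X' ω) ∂μ := by
    have h := (hswap.comp (u := fun p : 𝒳 × 𝒳 => Real.exp (θ * f p.1) * F p.1 p.2)
      (((hf.comp measurable_fst).const_mul θ).exp.mul hF)).integral_eq
    rw [← integral_neg]
    refine h.trans (integral_congr_ae (.of_forall fun ω => ?_))
    simp [hFanti (X ω) (X' ω)]
  have hsym : ∫ ω, Real.exp (θ * f (X ω)) * F (X ω) (X' ω) ∂μ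
      = ∫ ω, (Real.exp (θ * f (X ω)) * F (X ω) (X' ω)
        - Real.exp (θ * f (X' ω)) * F (X ω) (X' ω)) / 2 ∂μ := by
    rw [integral_div, integral_sub (hexpF θ) (hexpF' θ)]
    linarith
  have hright : |θ| * ∫ ω, Real.exp (θ * f (X ω)) * D ω ∂μ
      = ∫ ω, |θ| / 2 * (Real.exp (θ * f (X ω)) * D ω + Real.exp (θ * f (X' ω)) * D ω) ∂μ := by
    rw [integral_const_mul, integral_add hexpD hexpD', ← hexpD_swap.integral_eq]
    ring
  rw [hleft, integral_mul_condExp hX.comap_le hexpm hD hexpD, hsym, hright]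
  refine abs_integral_le_integral_abs.trans (integral_mono
    (((hexpF θ).sub (hexpF' θ)).div_const 2).abs
    ((hexpD.add hexpD').const_mul _) fun ω => ?_)
  have h := mul_le_mul_of_nonneg_right
    (abs_exp_sub_exp_le_mul_average (θ * f (X ω)) (θ * f (X' ω)))
    (abs_nonneg (F (X ω) (X' ω)))
  rw [← mul_sub, abs_mul θ] at h
  simp only [D]
  rw [← sub_mul, abs_div, abs_mul, abs_two, abs_mul (F (X ω) (X' ω))]
  linarith
end

section
/- Effect of the averaging operator D on degree and mean: Let φ be a homogeneous multilinear polynomial of degree d ≥ 1 in the indeterminates X_{ij}, i,j ∈ [n]. Then Dφ is a homogeneous multilinear polynomial of degree d−1 (satisfying the same multilinearity conditions), and E[Dφ] = (1 − (d−1)/n)·E[φ], where E denotes expectation over a uniformly random permutation of [n]. -/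
open MvPolynomial

noncomputable section

/-- `Dφ` for a homogeneous `φ` of degree `d`, as a polynomial:
`(1/(dn)) ∑_{i,j} ∂_{ij}φ`. -/
def DhomPoly (n d : ℕ) (φ : MvPolynomial (Fin n × Fin n) ℝ) :
    MvPolynomial (Fin n × Fin n) ℝ :=
  (1 / ((d : ℝ) * (n : ℝ))) • ∑ i : Fin n, ∑ j : Fin n, pderiv (i, j) φ

/-- Partial derivatives of multivariate polynomials commute. -/
theorem pderiv_pderiv_comm {ι : Type*} (a b : ι) (φ : MvPolynomial ι ℝ) :
    pderiv a (pderiv b φ) = pderiv b (pderiv a φ) := by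
  classical
  ext m
  simp only [coeff_pderiv, Finsupp.add_apply, Finsupp.single_apply]
  rw [add_right_comm]
  by_cases h : a = b
  · subst h; rfl
  · simp [h, Ne.symm h]
    ring

/-- If `∂_a ∂_b φ = 0`, then no monomial of `φ` is divisible by `X_a X_b`. -/
theorem coeff_add_single_add_single_eq_zero {ι : Type*} {a b : ι} {φ : MvPolynomial ι ℝ}
    (h : pderiv a (pderiv b φ) = 0) (m : ι →₀ ℕ) :
    coeff (m + Finsupp.single a 1 + Finsupp.single b 1) φ = 0 := by
  have h1 := congrArg (coeff m) h
  rw [coeff_pderiv, coeff_pderiv, coeff_zero, mul_eq_zero, mul_eq_zero] at h1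
  rcases h1 with (h1 | h1) | h1
  · exact h1
  · exact absurd h1 (by positivity)
  · exact absurd h1 (by positivity)

/-- If `∂_a ∂_b φ = 0`, then a monomial of `φ` involving `X_a` has degree one in `X_b` when
`a = b`, and does not involve `X_b` otherwise. -/
theorem apply_eq_ite_of_pderiv_pderiv_eq_zero {ι : Type*} [DecidableEq ι] {a b : ι}
    {φ : MvPolynomial ι ℝ} (h : pderiv a (pderiv b φ) = 0) {m : ι →₀ ℕ} (hm : m ∈ φ.support)
    (ha : m a ≠ 0) : m b = if a = b then 1 else 0 := by
  by_contra hb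
  have hle : Finsupp.single a 1 + Finsupp.single b 1 ≤ m := by
    intro x
    simp only [Finsupp.add_apply, Finsupp.single_apply]
    by_cases hab : a = b
    · subst hab
      split_ifs at hb ⊢ <;> simp_all; omega
    · rw [if_neg hab] at hb
      by_cases hx : a = x
      · subst hx
        rw [if_pos rfl, if_neg (Ne.symm hab)]
        omega
      · rw [if_neg hx]
        split_ifs with hbx
        · subst hbx; omega
        · omega
  obtain ⟨m', rfl⟩ := exists_add_of_le hle
  rw [mem_support_iff, add_comm, ← add_assoc] at hm
  exact hm (coeff_add_single_add_single_eq_zero h m')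

/-- The exponent vector `m` is a `0`-`1` matrix with at most one `1` in each row and column. -/
def IsPartialPerm (n : ℕ) (m : Fin n × Fin n →₀ ℕ) : Prop :=
  ∀ i j k : Fin n, (m (i, j) ≠ 0 → m (i, k) = if j = k then 1 else 0) ∧
    (m (j, i) ≠ 0 → m (k, i) = if j = k then 1 else 0)

theorem IsMultilinear.isPartialPerm {n : ℕ} {φ : MvPolynomial (Fin n × Fin n) ℝ}
    (h : IsMultilinear n φ) {m : Fin n × Fin n →₀ ℕ} (hm : m ∈ φ.support) :
    IsPartialPerm n m := by
  intro i j k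
  refine ⟨fun h0 => ?_, fun h0 => ?_⟩
  · simpa using apply_eq_ite_of_pderiv_pderiv_eq_zero (h i j k).1 hm h0
  · simpa using apply_eq_ite_of_pderiv_pderiv_eq_zero (h i j k).2 hm h0

theorem permEval_monomial (n : ℕ) (m : Fin n × Fin n →₀ ℕ) (c : ℝ) (σ : Equiv.Perm (Fin n)) :
    permEval n (monomial m c) σ = c * ∏ p, permMat n σ p ^ m p := by
  rw [permEval, eval_monomial, Finsupp.prod_fintype _ _ (fun _ => pow_zero _)]

/-- A monomial involving `X_{ab}` vanishes at `σ` unless `σ a = b`. -/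
theorem permEval_monomial_eq_zero {n : ℕ} {m : Fin n × Fin n →₀ ℕ} {c : ℝ}
    {σ : Equiv.Perm (Fin n)} {a b : Fin n} (hm : m (a, b) ≠ 0) (hσ : σ a ≠ b) :
    permEval n (monomial m c) σ = 0 := by
  rw [permEval_monomial, Finset.prod_eq_zero (Finset.mem_univ (a, b)), mul_zero]
  simp [permMat, hσ, hm]

/-- Swapping two columns not involved in a monomial does not change its value. -/
theorem permEval_monomial_swap_mul {n : ℕ} {m : Fin n × Fin n →₀ ℕ} {c : ℝ} {j k : Fin n}
    (hj : ∀ a, m (a, j) = 0) (hk : ∀ a, m (a, k) = 0) (σ : Equiv.Perm (Fin n)) :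
    permEval n (monomial m c) (Equiv.swap j k * σ) = permEval n (monomial m c) σ := by
  simp only [permEval_monomial]
  congr 1
  refine Finset.prod_congr rfl fun p _ => ?_
  obtain ⟨a, b⟩ := p
  by_cases hb : m (a, b) = 0
  · simp [hb]
  have hbj : b ≠ j := by rintro rfl; exact hb (hj a)
  have hbk : b ≠ k := by rintro rfl; exact hb (hk a)
  have : Equiv.swap j k (σ a) = b ↔ σ a = b := by
    rw [Equiv.swap_apply_eq_iff, Equiv.swap_apply_of_ne_of_ne hbj hbk]
  simp [permMat, this]

/-- If `X_{ij} X^m` is the monomial of a partial permutation, then the sum of `c X^m` over all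
permutations is `n - deg X^m` times the sum of `c X_{ij} X^m`. -/
theorem sum_permEval_monomial {n : ℕ} {m : Fin n × Fin n →₀ ℕ} (c : ℝ) {i j : Fin n}
    (hm : IsPartialPerm n (m + Finsupp.single (i, j) 1)) :
    ∑ σ, permEval n (monomial m c) σ =
      ((n : ℝ) - ∑ p, (m p : ℝ)) *
        ∑ σ, permEval n (monomial (m + Finsupp.single (i, j) 1) c) σ := by
  have hrow (k : Fin n) : m (i, k) = 0 := by
    have := (hm i j k).1 (by simp)
    simp only [Finsupp.add_apply, Finsupp.single_apply, Prod.mk.injEq, true_and] at this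
    omega
  have hcol (a : Fin n) : m (a, j) = 0 := by
    have := (hm j i a).2 (by simp)
    simp only [Finsupp.add_apply, Finsupp.single_apply, Prod.mk.injEq, and_true] at this
    omega
  have hX (σ : Equiv.Perm (Fin n)) : permEval n (monomial (m + Finsupp.single (i, j) 1) c) σ =
      if σ i = j then permEval n (monomial m c) σ else 0 := by
    rw [permEval, permEval, monomial_add_single, map_mul, map_pow, eval_X, permMat]
    simp
  have key (k : Fin n) : (∑ σ : Equiv.Perm (Fin n),
      if σ i = k then permEval n (monomial m c) σ else 0) =
      (1 - ∑ a, (m (a, k) : ℝ)) *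
        ∑ σ, permEval n (monomial (m + Finsupp.single (i, j) 1) c) σ := by
    by_cases hk : ∀ a, m (a, k) = 0
    · simp only [hk, Nat.cast_zero, Finset.sum_const_zero, sub_zero, one_mul]
      refine Fintype.sum_equiv (Equiv.mulLeft (Equiv.swap j k)) _ _ fun σ => ?_
      rw [hX, Equiv.coe_mulLeft, permEval_monomial_swap_mul hcol hk, Equiv.Perm.mul_apply]
      simp only [Equiv.swap_apply_eq_iff, Equiv.swap_apply_left]
    · push Not at hk
      obtain ⟨a, ha⟩ := hk
      have hkj : j ≠ k := by rintro rfl; exact ha (hcol a)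
      have hsum : ∑ b, (m (b, k) : ℝ) = 1 := by
        have hb (b : Fin n) : m (b, k) = if a = b then 1 else 0 := by
          have := (hm k a b).2 (by simp [ha])
          simpa [Finsupp.single_apply, hkj] using this
        simp [hb]
      rw [hsum, sub_self, zero_mul]
      refine Finset.sum_eq_zero fun σ _ => ?_
      split_ifs with hσ
      · refine permEval_monomial_eq_zero ha fun h => ?_
        have : a = i := σ.injective (h.trans hσ.symm)
        subst this
        exact ha (hrow k)
      · rfl
  calc ∑ σ, permEval n (monomial m c) σ
      = ∑ σ : Equiv.Perm (Fin n), ∑ k, if σ i = k then permEval n (monomial m c) σ else 0 := by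
        simp
    _ = ∑ k, (1 - ∑ a, (m (a, k) : ℝ)) *
        ∑ σ, permEval n (monomial (m + Finsupp.single (i, j) 1) c) σ := by
        rw [Finset.sum_comm]
        exact Finset.sum_congr rfl fun k _ => key k
    _ = _ := by
        rw [← Finset.sum_mul, Finset.sum_sub_distrib, Fintype.sum_prod_type_right]
        simp

/-- The sum of `∂_p (c X^m)` over all permutations, for the monomial of a partial permutation. -/
theorem sum_permEval_pderiv_monomial {n : ℕ} {m : Fin n × Fin n →₀ ℕ} (c : ℝ)
    (hm : IsPartialPerm n m) (p : Fin n × Fin n) :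
    ∑ σ, permEval n (pderiv p (monomial m c)) σ =
      m p * (((n : ℝ) - (∑ q, (m q : ℝ)) + 1) * ∑ σ, permEval n (monomial m c) σ) := by
  obtain ⟨i, j⟩ := p
  rw [pderiv_monomial]
  by_cases h0 : m (i, j) = 0
  · simp [h0, permEval]
  have h1 : m (i, j) = 1 := by simpa using (hm i j j).1 h0
  obtain ⟨m', rfl⟩ : ∃ m', m = m' + Finsupp.single (i, j) 1 :=
    ⟨m - Finsupp.single (i, j) 1, (tsub_add_cancel_of_le (by simp [h1])).symm⟩
  rw [h1, add_tsub_cancel_right, Nat.cast_one, mul_one, one_mul, sum_permEval_monomial c hm]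
  have : ∑ q, ((m' + Finsupp.single (i, j) 1 : Fin n × Fin n →₀ ℕ) q : ℝ) = (∑ q, (m' q : ℝ)) + 1 := by
    simp [Finset.sum_add_distrib, Finsupp.single_apply]
  rw [this]
  ring

/-- The sum over all permutations of `∑_{ij} ∂_{ij} φ` is `d (n - d + 1)` times that of `φ`. -/
theorem sum_permEval_sum_pderiv {n d : ℕ} {φ : MvPolynomial (Fin n × Fin n) ℝ}
    (hml : IsMultilinear n φ) (hhom : φ.IsHomogeneous d) :
    ∑ σ, permEval n (∑ i, ∑ j, pderiv (i, j) φ) σ =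
      d * ((n : ℝ) - d + 1) * ∑ σ, permEval n φ σ := by
  have hmono (m) (hm : m ∈ φ.support) :
      ∑ p, ∑ σ, permEval n (pderiv p (monomial m (coeff m φ))) σ =
        d * ((n : ℝ) - d + 1) * ∑ σ, permEval n (monomial m (coeff m φ)) σ := by
    have hdeg : ∑ p, (m p : ℝ) = d := by
      rw [← hhom (mem_support_iff.1 hm), Pi.one_def, ← Finsupp.degree_eq_weight_one,
        Finsupp.degree_eq_sum, Nat.cast_sum]
    simp_rw [sum_permEval_pderiv_monomial _ (hml.isPartialPerm hm)]
    rw [← Finset.sum_mul, hdeg]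
    ring
  have hadd (σ : Equiv.Perm (Fin n)) (p) : permEval n (pderiv p φ) σ =
      ∑ m ∈ φ.support, permEval n (pderiv p (monomial m (coeff m φ))) σ := by
    conv_lhs => rw [φ.as_sum]
    simp only [permEval, map_sum]
  have hφ (σ : Equiv.Perm (Fin n)) : permEval n φ σ =
      ∑ m ∈ φ.support, permEval n (monomial m (coeff m φ)) σ := by
    conv_lhs => rw [φ.as_sum]
    simp only [permEval, map_sum]
  calc ∑ σ, permEval n (∑ i, ∑ j, pderiv (i, j) φ) σ
      = ∑ σ, ∑ p, permEval n (pderiv p φ) σ := by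
        simp only [permEval, map_sum, Fintype.sum_prod_type]
    _ = ∑ m ∈ φ.support, ∑ p, ∑ σ, permEval n (pderiv p (monomial m (coeff m φ))) σ := by
        rw [Finset.sum_comm, Finset.sum_comm (s := φ.support)]
        refine Finset.sum_congr rfl fun p _ => ?_
        rw [Finset.sum_comm (s := φ.support)]
        exact Finset.sum_congr rfl fun σ _ => hadd σ p
    _ = _ := by
        rw [Finset.sum_congr rfl hmono, ← Finset.mul_sum, Finset.sum_comm]
        simp only [hφ]

/-- Lemma 9.5 (iii): for a homogeneous multilinear `φ` of degree `d ≥ 1`, `Dφ` is a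
homogeneous multilinear polynomial of degree `d − 1` and
`E[Dφ] = (1 − (d−1)/n)·E[φ]`. -/
theorem D_degree_and_mean (n d : ℕ) (hn : 1 ≤ n) (hd : 1 ≤ d)
    (φ : MvPolynomial (Fin n × Fin n) ℝ)
    (hml : IsMultilinear n φ) (hhom : φ.IsHomogeneous d) :
    (DhomPoly n d φ).IsHomogeneous (d - 1) ∧
    IsMultilinear n (DhomPoly n d φ) ∧
    permExp n (DhomPoly n d φ) = (1 - ((d : ℝ) - 1) / (n : ℝ)) * permExp n φ := by
  refine ⟨?_, ?_, ?_⟩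
  · rw [DhomPoly, smul_eq_C_mul]
    refine IsHomogeneous.C_mul ?_ _
    exact IsHomogeneous.sum _ _ _ fun i _ => IsHomogeneous.sum _ _ _ fun j _ => hhom.pderiv
  · have hcomm (a b : Fin n × Fin n) (h : pderiv a (pderiv b φ) = 0) :
        pderiv a (pderiv b (DhomPoly n d φ)) = 0 := by
      have (p : Fin n × Fin n) : pderiv a (pderiv b (pderiv p φ)) = 0 := by
        rw [pderiv_pderiv_comm b p, pderiv_pderiv_comm a p, h, map_zero]
      simp [DhomPoly, this]
    exact fun i j k => ⟨hcomm _ _ (hml i j k).1, hcomm _ _ (hml i j k).2⟩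
  · have hsmul (σ : Equiv.Perm (Fin n)) : permEval n (DhomPoly n d φ) σ =
        1 / ((d : ℝ) * n) * permEval n (∑ i, ∑ j, pderiv (i, j) φ) σ := by
      rw [permEval, DhomPoly, smul_eval, permEval]
    have hn0 : (n : ℝ) ≠ 0 := by positivity
    have hd0 : (d : ℝ) ≠ 0 := by positivity
    simp only [permExp, hsmul]
    rw [← Finset.mul_sum, sum_permEval_sum_pderiv hml hhom]
    field_simp
    ring
end
end
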